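/- arXiv:1804.09019 — 5 statements merged into one kernel-verified Lean document; each statement's English description precedes it below -/
import Mathlib

section
/- A finite simple graph G is strongly chordal if and only if it admits a strong elimination ordering of its vertices. -/
/-- A cycle of length `n` in `G`, given as an injective map from `ZMod n`
whose consecutive images are adjacent. -/
def SimpleGraph.IsCycleEmb {V : Type*} (G : SimpleGraph V) {n : ℕ} (f : ZMod n → V) : Prop :=
  Function.Injective f ∧ ∀ i : ZMod n, G.Adj (f i) (f (i + 1))

/-- A chord of the cycle `f`: an edge of `G` joining two non-consecutive
vertices of the cycle. -/
def SimpleGraph.IsChordOf {V : Type*} (G : SimpleGraph V) {n : ℕ} (f : ZMod n → V)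
    (i j : ZMod n) : Prop :=
  G.Adj (f i) (f j) ∧ j ≠ i + 1 ∧ i ≠ j + 1

/-- A graph is chordal if every cycle of length at least 4 has a chord,
i.e. it has no chordless cycle of size 4 or more. -/
def SimpleGraph.Chordal {V : Type*} (G : SimpleGraph V) : Prop :=
  ∀ (n : ℕ), 4 ≤ n → ∀ f : ZMod n → V, G.IsCycleEmb f → ∃ i j, G.IsChordOf f i j

/-- A strong chord of the (even) cycle `f`: a chord joining two vertices whose
distance apart along the cycle is odd. -/
def SimpleGraph.IsStrongChordOf {V : Type*} (G : SimpleGraph V) {n : ℕ} (f : ZMod n → V)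
    (i j : ZMod n) : Prop :=
  G.IsChordOf f i j ∧ Odd (j - i).val

/-- A graph is strongly chordal if it is chordal and every even cycle of length
at least 6 has a strong chord. -/
def SimpleGraph.StronglyChordal {V : Type*} (G : SimpleGraph V) : Prop :=
  G.Chordal ∧ ∀ (n : ℕ), 6 ≤ n → Even n → ∀ f : ZMod n → V, G.IsCycleEmb f →
    ∃ i j, G.IsStrongChordOf f i j

/-- The closed neighborhood `N[v]` of a vertex `v`. -/
def SimpleGraph.closedNbhd {V : Type*} (G : SimpleGraph V) (v : V) : Set V :=
  insert v (G.neighborSet v)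

/-- A vertex is simplicial if its open neighborhood induces a clique. -/
def SimpleGraph.IsSimplicialVertex {V : Type*} (G : SimpleGraph V) (v : V) : Prop :=
  ∀ u w, G.Adj v u → G.Adj v w → u ≠ w → G.Adj u w

/-- A vertex is simple if the vertices in its closed neighborhood are pairwise
compatible, i.e. their closed neighborhoods are linearly ordered by inclusion. -/
def SimpleGraph.IsSimpleVertex {V : Type*} (G : SimpleGraph V) (v : V) : Prop :=
  ∀ u w, u ∈ G.closedNbhd v → w ∈ G.closedNbhd v →
    G.closedNbhd u ⊆ G.closedNbhd w ∨ G.closedNbhd w ⊆ G.closedNbhd u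

/-- A perfect elimination ordering: each `σ i` is simplicial in the subgraph of `G`
induced by the vertex set `{σ j : i ≤ j}`. -/
def SimpleGraph.IsPerfectElimOrdering {V : Type*} [Fintype V] (G : SimpleGraph V)
    (σ : Fin (Fintype.card V) ≃ V) : Prop :=
  ∀ i : Fin (Fintype.card V),
    (G.induce (σ '' {j | i ≤ j})).IsSimplicialVertex ⟨σ i, ⟨i, le_refl i, rfl⟩⟩

/-- A strong elimination ordering: for all `i < j` and `k < l`, if
`σ k, σ l ∈ N[σ i]` and `σ k ∈ N[σ j]`, then `σ l ∈ N[σ j]`. -/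
def SimpleGraph.IsStrongElimOrdering {V : Type*} [Fintype V] (G : SimpleGraph V)
    (σ : Fin (Fintype.card V) ≃ V) : Prop :=
  ∀ i j k l : Fin (Fintype.card V), i < j → k < l →
    σ k ∈ G.closedNbhd (σ i) → σ l ∈ G.closedNbhd (σ i) →
    σ k ∈ G.closedNbhd (σ j) → σ l ∈ G.closedNbhd (σ j)

namespace SCAux
open Finset

/-- Closed adjacency. -/
def N {V : Type*} (G : SimpleGraph V) (x y : V) : Prop := x = y ∨ G.Adj x y

theorem mem_closedNbhd {V : Type*} (G : SimpleGraph V) (x y : V) :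
    y ∈ G.closedNbhd x ↔ N G x y := by
  simp [SimpleGraph.closedNbhd, N, eq_comm]

theorem N_symm {V : Type*} {G : SimpleGraph V} {x y : V} (h : N G x y) : N G y x := by
  rcases h with h | h
  · exact Or.inl h.symm
  · exact Or.inr h.symm

theorem N_comm {V : Type*} {G : SimpleGraph V} {x y : V} : N G x y ↔ N G y x :=
  ⟨N_symm, N_symm⟩

theorem N_refl {V : Type*} {G : SimpleGraph V} (x : V) : N G x x := Or.inl rfl

theorem N.adj {V : Type*} {G : SimpleGraph V} {x y : V} (h : N G x y) (hne : x ≠ y) :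
    G.Adj x y := h.resolve_left hne

/-- The reverse direction. -/
theorem backward {V : Type*} [LinearOrder V] (G : SimpleGraph V)
    (h : ∀ i j k l : V, i < j → k < l → N G i k → N G i l → N G j k → N G j l) :
    G.StronglyChordal := by
  constructor
  · intro n hn f ⟨hinj, hadj⟩
    have : NeZero n := ⟨by omega⟩
    obtain ⟨i, hi⟩ := Finite.exists_min f
    have c2 : (2 : ZMod n) ≠ 0 := by
      intro h0
      have : ((2 : ℕ) : ZMod n) = 0 := by exact_mod_cast h0
      rw [ZMod.natCast_eq_zero_iff] at this
      exact absurd (Nat.le_of_dvd (by norm_num) this) (by omega)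
    have c3 : (3 : ZMod n) ≠ 0 := by
      intro h0
      have : ((3 : ℕ) : ZMod n) = 0 := by exact_mod_cast h0
      rw [ZMod.natCast_eq_zero_iff] at this
      exact absurd (Nat.le_of_dvd (by norm_num) this) (by omega)
    have h1 := hadj i
    have h2 := hadj (i - 1)
    rw [sub_add_cancel] at h2
    have hne : f (i - 1) ≠ f (i + 1) := by
      intro he
      have := hinj he
      apply c2
      linear_combination -this
    have hlt : f i < f (i - 1) := lt_of_le_of_ne (hi _) h2.ne'
    have := h (f i) (f (i - 1)) (f i) (f (i + 1)) hlt (lt_of_le_of_ne (hi _) h1.ne)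
      (N_refl _) (Or.inr h1) (Or.inr h2)
    refine ⟨i - 1, i + 1, this.adj hne, ?_, ?_⟩
    · intro he
      have := h1.ne
      apply this; congr 1; linear_combination -he
    · intro he; apply c3; linear_combination -he
  · intro n hn hev f ⟨hinj, hadj⟩
    have : NeZero n := ⟨by omega⟩
    obtain ⟨i, hi⟩ := Finite.exists_min f
    have cc : ∀ k : ℕ, 0 < k → k < 6 → (k : ZMod n) ≠ 0 := by
      intro k hk hk' h0
      rw [ZMod.natCast_eq_zero_iff] at h0
      exact absurd (Nat.le_of_dvd hk h0) (by omega)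
    have c2 := cc 2 (by omega) (by omega)
    have c3 := cc 3 (by omega) (by omega)
    have c4 := cc 4 (by omega) (by omega)
    push_cast at c2 c3 c4
    have v3 : ((3 : ZMod n)).val = 3 := by
      have := ZMod.val_natCast_of_lt (show 3 < n by omega)
      exact_mod_cast this
    have h1 := hadj i
    have h2 := hadj (i - 1)
    rw [sub_add_cancel] at h2
    have h3 := hadj (i - 1 - 1)
    rw [sub_add_cancel] at h3
    have h4 := hadj (i + 1)
    have hne : f (i - 1) ≠ f (i + 1) := by
      intro he
      have := hinj he
      apply c2
      linear_combination -this
    rcases lt_or_gt_of_ne hne with hlt | hlt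
    · have hlt' : f i < f (i - 1 - 1) := by
        refine lt_of_le_of_ne (hi _) fun he => c2 ?_
        have := hinj he
        linear_combination this
      have := h _ _ _ _ hlt' hlt (Or.inr h2.symm) (Or.inr h1) (Or.inr h3)
      refine ⟨i - 1 - 1, i + 1, ⟨this.adj fun he => c3 ?_, fun he => c2 ?_, fun he => c4 ?_⟩, ?_⟩
      · have := hinj he
        linear_combination -this
      · linear_combination he
      · linear_combination -he
      · rw [show i + 1 - (i - 1 - 1) = 3 by ring, v3]; decide
    · have hlt' : f i < f (i + 1 + 1) := by
        refine lt_of_le_of_ne (hi _) fun he => c2 ?_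
        have := hinj he
        linear_combination -this
      have := h _ _ _ _ hlt' hlt (Or.inr h1) (Or.inr h2.symm) (Or.inr h4.symm)
      refine ⟨i - 1, i + 1 + 1, ⟨(N_symm this).adj fun he => c3 ?_, fun he => c2 ?_,
        fun he => c4 ?_⟩, ?_⟩
      · have := hinj he
        linear_combination -this
      · linear_combination he
      · linear_combination -he
      · rw [show i + 1 + 1 - (i - 1) = 3 by ring, v3]; decide

/-- In a chordal graph, two nonadjacent neighbours of `v` are not joined by a walk
avoiding `N[v]`. -/
theorem chordal_walk {V : Type*} (G : SimpleGraph V) (hG : G.Chordal) (v u w : V)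
    (hvu : G.Adj v u) (hvw : G.Adj v w) (huw : ¬ N G u w) (k0 : ℕ) (h0 : ℕ → V)
    (hs : h0 0 = u) (he : h0 k0 = w) (hstep : ∀ i < k0, N G (h0 i) (h0 (i + 1)))
    (hav : ∀ i, 0 < i → i < k0 → ¬ N G v (h0 i)) : False := by
  classical
  have hex : ∃ k : ℕ, ∃ h : ℕ → V, h 0 = u ∧ h k = w ∧ (∀ i < k, N G (h i) (h (i + 1))) ∧
    (∀ i, 0 < i → i < k → ¬ N G v (h i)) := ⟨k0, h0, hs, he, hstep, hav⟩
  clear hs he hstep hav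
  set k := Nat.find hex with hk
  obtain ⟨h, hs, he, hstep, hav⟩ := Nat.find_spec hex
  rw [← hk] at he hstep hav
  have hmin : ∀ m < k, ¬ _ := fun m hm => Nat.find_min hex hm
  clear_value k
  have hk2 : 2 ≤ k := by
    by_contra hlt
    have : k = 0 ∨ k = 1 := by omega
    rcases this with rfl | rfl
    · exact huw (Or.inl (hs.symm.trans he))
    · exact huw (by have := hstep 0 (by omega); rwa [hs, he] at this)
  have short : ∀ i j, i + 1 < j → j ≤ k → ¬ N G (h i) (h j) := by
    intro i j hij hjk hN
    refine hmin (k - (j - i - 1)) (by omega) ⟨fun m => if m ≤ i then h m else h (m + (j - i - 1)),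
      ?_, ?_, ?_, ?_⟩
    · simp [hs]
    · simp only
      rw [if_neg (by omega)]
      rw [show k - (j - i - 1) + (j - i - 1) = k by omega, he]
    · intro m hm
      simp only
      split_ifs with h1 h2 h2
      · exact hstep m (by omega)
      · have : m = i := by omega
        subst this
        rwa [show m + 1 + (j - m - 1) = j by omega]
      · omega
      · have := hstep (m + (j - i - 1)) (by omega)
        rwa [show m + 1 + (j - i - 1) = m + (j - i - 1) + 1 by omega]
    · intro m hm0 hm
      simp only
      split_ifs with h1
      · exact hav m hm0 (by omega)
      · exact hav _ (by omega) (by omega)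
  have hne : ∀ i j, i < j → j ≤ k → h i ≠ h j := by
    intro i j hij hjk heq
    rcases Nat.lt_or_ge (i + 1) j with h1 | h1
    · exact short i j h1 hjk (Or.inl heq)
    · have : j = i + 1 := by omega
      subst this
      rcases Nat.lt_or_ge (i + 1) k with h2 | h2
      · have := hstep (i + 1) h2
        rw [← heq] at this
        exact short i (i + 1 + 1) (by omega) (by omega) this
      · have h3 : 0 < i := by omega
        have := hstep (i - 1) (by omega)
        rw [show i - 1 + 1 = i by omega, heq] at this
        exact short (i - 1) (i + 1) (by omega) (by omega) this
  have hvne : ∀ i, i ≤ k → h i ≠ v := by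
    intro i hi heq
    rcases Nat.eq_zero_or_pos i with rfl | h1
    · rw [hs] at heq; exact hvu.ne heq.symm
    · rcases Nat.lt_or_ge i k with h2 | h2
      · exact hav i h1 h2 (Or.inl heq.symm)
      · have : i = k := by omega
        subst this
        rw [he] at heq; exact hvw.ne heq.symm
  have : NeZero (k + 2) := ⟨by omega⟩
  have : Fact (1 < k + 2) := ⟨by omega⟩
  have hsucc : ∀ x : ZMod (k + 2), (x.val < k + 1 → (x + 1).val = x.val + 1) ∧
      (x.val = k + 1 → x + 1 = 0) := by
    intro x
    constructor
    · intro hx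
      rw [ZMod.val_add_of_lt]
      · rw [ZMod.val_one]
      · rw [ZMod.val_one]; omega
    · intro hx
      have h5 : ((x.val : ℕ) : ZMod (k + 2)) = x := ZMod.natCast_zmod_val x
      rw [hx] at h5
      rw [← h5]
      have := ZMod.natCast_self (k + 2)
      push_cast at this ⊢
      linear_combination this
  obtain ⟨x, y, hadj, hxy, hyx⟩ := hG (k + 2) (by omega)
    (fun x => if x.val ≤ k then h x.val else v) ⟨by
      intro x y hxy
      simp only at hxy
      apply ZMod.val_injective
      have hx := ZMod.val_lt x
      have hy := ZMod.val_lt y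
      split_ifs at hxy with h1 h2 h2
      · rcases lt_trichotomy x.val y.val with h3 | h3 | h3
        · exact absurd hxy (hne _ _ h3 h2)
        · exact h3
        · exact absurd hxy.symm (hne _ _ h3 h1)
      · exact absurd hxy (hvne _ h1)
      · exact absurd hxy.symm (hvne _ h2)
      · omega, by
      intro x
      simp only
      have hx := ZMod.val_lt x
      rcases Nat.lt_or_ge x.val (k + 1) with h1 | h1
      · rw [(hsucc x).1 h1, if_pos (by omega)]
        split_ifs with h2
        · exact (hstep _ (by omega)).adj (hne _ _ (by omega) h2)
        · rw [show x.val = k by omega, he]; exact hvw.symm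
      · rw [(hsucc x).2 (by omega), if_neg (by omega)]
        simp [hs, hvu]⟩
  have key : ∀ x y : ZMod (k + 2), x.val < y.val →
      G.Adj (if x.val ≤ k then h x.val else v) (if y.val ≤ k then h y.val else v) →
      y ≠ x + 1 → x ≠ y + 1 → False := by
    intro x y hlt hadj hxy hyx
    have hy := ZMod.val_lt y
    rw [if_pos (by omega)] at hadj
    have h1 : x.val + 1 < y.val := by
      by_contra hc
      apply hxy
      apply ZMod.val_injective
      rw [(hsucc x).1 (by omega)]; omega
    split_ifs at hadj with h2
    · exact short _ _ h1 h2 (Or.inr hadj)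
    · rcases Nat.eq_zero_or_pos x.val with h3 | h3
      · apply hyx
        rw [(hsucc y).2 (by omega)]
        exact (ZMod.val_eq_zero x).1 h3
      · exact hav _ h3 (by omega) (Or.inr hadj.symm)
  rcases lt_trichotomy x.val y.val with h1 | h1 | h1
  · exact key x y h1 hadj hxy hyx
  · simp only [h1] at hadj
    exact hadj.ne rfl
  · exact key y x h1 hadj.symm hyx hxy

/-- No induced even cycle in the closed neighbourhood incidence. -/
theorem no_cycle {V : Type*} (G : SimpleGraph V) (hG : G.StronglyChordal) (n : ℕ) (hn : 6 ≤ n)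
    (hev : Even n) (g : ZMod n → V)
    (H : ∀ x : ZMod n, ∀ k : ℕ, k < n → Odd k → (N G (g x) (g (x + k)) ↔ k = 1 ∨ k = n - 1)) :
    False := by
  have : NeZero n := ⟨by omega⟩
  obtain ⟨s, hs⟩ := hev
  have ncast : (n : ZMod n) = 0 := ZMod.natCast_self n
  have H1 : ∀ x, N G (g x) (g (x + 1)) := by
    intro x
    have := (H x 1 (by omega) (by decide)).2 (Or.inl rfl)
    simpa using this
  have hpar1 : ∀ x : ZMod n, ∀ k : ℕ, 0 < k → k < n → Even k → g x = g (x + k) → k = 2 := by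
    intro x k hk hkn hke heq
    obtain ⟨t, ht⟩ := hke
    have h1 := N_symm (H1 x)
    rw [heq] at h1
    have h2 := (H (x + 1) (k - 1) (by omega) ⟨t - 1, by omega⟩).1 (by
      convert h1 using 2
      rw [Nat.cast_sub (by omega)]; push_cast; ring)
    omega
  have hpar : ∀ x : ZMod n, ∀ k : ℕ, 0 < k → k < n → Even k → g x ≠ g (x + k) := by
    intro x k hk hkn hke heq
    have h1 := hpar1 x k hk hkn hke heq
    have h2 := hpar1 (x + k) (n - k) (by omega) (by omega)
      (by obtain ⟨t, ht⟩ := hke; exact ⟨s - t, by omega⟩) (by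
        rw [← heq]; congr 1
        rw [Nat.cast_sub (by omega), ncast]; ring)
    omega
  have hcon : ∀ x, g x ≠ g (x + 1) := by
    intro x heq
    refine chordal_walk G hG.1 (g x) (g (x + 2)) (g (x + (n - 1 : ℕ))) ?_ ?_ ?_ (n - 3)
      (fun m => g (x + 2 + m)) (by simp) ?_ ?_ ?_
    · have h1 := H1 (x + 1)
      rw [← heq, add_assoc, one_add_one_eq_two] at h1
      have h2 := hpar x 2 (by omega) (by omega) (by decide)
      push_cast at h2
      exact h1.adj h2
    · have h1 := (H x (n - 1) (by omega) ⟨s - 1, by omega⟩).2 (Or.inr rfl)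
      refine h1.adj ?_
      rw [heq]
      have h2 := hpar (x + 1) (n - 2) (by omega) (by omega) ⟨s - 1, by omega⟩
      convert h2 using 2
      rw [Nat.cast_sub (by omega), Nat.cast_sub (by omega)]; push_cast; ring
    · intro h1
      have h2 := (H (x + 2) (n - 3) (by omega) ⟨s - 2, by omega⟩).1 (by
        convert h1 using 2
        rw [Nat.cast_sub (by omega), Nat.cast_sub (by omega)]; push_cast; ring)
      omega
    · congr 1
      rw [Nat.cast_sub (by omega), Nat.cast_sub (by omega)]; push_cast; ring
    · intro m hm
      convert H1 (x + 2 + m) using 2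
      push_cast; ring
    · intro m hm0 hm hN
      rcases Nat.even_or_odd m with ⟨t, ht⟩ | ⟨t, ht⟩
      · rw [heq] at hN
        have h2 := (H (x + 1) (m + 1) (by omega) ⟨t, by omega⟩).1 (by
          convert hN using 2
          push_cast; ring)
        omega
      · have h2 := (H x (m + 2) (by omega) ⟨t + 1, by omega⟩).1 (by
          convert hN using 2
          push_cast; ring)
        omega
  have hsub : ∀ x y : ZMod n, y = x + ((y - x).val : ℕ) := by
    intro x y
    rw [ZMod.natCast_zmod_val]; ring
  have hend : ∀ x : ZMod n, x + ((n - 1 : ℕ) : ZMod n) + 1 = x := by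
    intro x
    rw [Nat.cast_sub (by omega), ncast]; push_cast; ring
  have hinj : Function.Injective g := by
    intro x y heq
    by_contra hne
    have h1 := hsub x y
    have h2 := ZMod.val_lt (y - x)
    have h3 : (y - x).val ≠ 0 := by
      rw [Ne, ZMod.val_eq_zero, sub_eq_zero]; exact fun h => hne h.symm
    generalize (y - x).val = k at *
    subst h1
    rcases Nat.even_or_odd k with h4 | h4
    · exact hpar x k (by omega) h2 h4 heq
    · rcases (H x k h2 h4).1 (Or.inl heq) with rfl | rfl
      · exact hcon x (by simpa using heq)
      · refine hcon (x + ((n - 1 : ℕ) : ZMod n)) ?_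
        rw [hend, heq]
  obtain ⟨x, y, ⟨hadj, hxy, hyx⟩, hodd⟩ := hG.2 n hn ⟨s, hs⟩ g
    ⟨hinj, fun x => (H1 x).adj (hcon x)⟩
  have h1 := hsub x y
  have h2 := ZMod.val_lt (y - x)
  generalize (y - x).val = k at *
  subst h1
  rcases (H x k h2 hodd).1 (Or.inr hadj) with rfl | rfl
  · exact hxy (by simp)
  · exact hyx (hend x).symm

end SCAux

namespace SCAux
open Finset

theorem no_ladder {V : Type*} (G : SimpleGraph V) (hG : G.StronglyChordal) (t : ℕ) (ht : 2 ≤ t)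
    (r c : ℕ → V)
    (H : ∀ i j, i ≤ t → j ≤ t → (N G (r i) (c j) ↔
      (i = 0 ∧ j = 0) ∨ (i = t ∧ j = t) ∨ i = j + 1 ∨ j = i + 1)) : False := by
  classical
  let ρ : ℕ → ℕ := fun p => if p ≤ t then p else 2 * t + 1 - p
  have hρ : ∀ p, (p ≤ t ∧ ρ p = p) ∨ (t < p ∧ ρ p = 2 * t + 1 - p) := by
    intro p
    simp only [ρ]
    split_ifs with h
    · exact Or.inl ⟨h, rfl⟩
    · exact Or.inr ⟨by omega, rfl⟩
  clear_value ρ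
  let F : ℕ → V := fun p => if p % 2 = 0 then r (ρ p) else c (ρ p)
  have h0 : ∀ p q, p < 2 * t + 2 → q < 2 * t + 2 → p % 2 = 0 → q % 2 = 1 →
      (N G (F p) (F q) ↔ q = p + 1 ∨ p = q + 1 ∨ (p = 0 ∧ q = 2 * t + 1)) := by
    intro p q hp hq hp2 hq2
    simp only [F]
    rw [if_pos hp2, if_neg (by omega)]
    have h1 := hρ p
    have h2 := hρ q
    rw [H _ _ (by omega) (by omega)]
    omega
  have h1 : ∀ p q, p < 2 * t + 2 → q < 2 * t + 2 → p % 2 ≠ q % 2 →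
      (N G (F p) (F q) ↔ q = p + 1 ∨ p = q + 1 ∨ (p = 0 ∧ q = 2 * t + 1) ∨
        (q = 0 ∧ p = 2 * t + 1)) := by
    intro p q hp hq hpq
    rcases Nat.mod_two_eq_zero_or_one p with h2 | h2
    · rw [h0 p q hp hq h2 (by omega)]; omega
    · rw [N_comm, h0 q p hq hp (by omega) h2]; omega
  clear_value F
  have : NeZero (2 * t + 2) := ⟨by omega⟩
  refine no_cycle G hG (2 * t + 2) (by omega) ⟨t + 1, by ring⟩ (fun x => F x.val) ?_
  rintro x k hk ⟨m, hm⟩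
  have hx := ZMod.val_lt x
  have hv : (x + (k : ZMod (2 * t + 2))).val = (x.val + k) % (2 * t + 2) := by
    rw [ZMod.val_add, ZMod.val_natCast, Nat.add_mod_mod]
  have hv' : ((x.val + k) % (2 * t + 2) = x.val + k ∧ x.val + k < 2 * t + 2) ∨
      ((x.val + k) % (2 * t + 2) = x.val + k - (2 * t + 2) ∧ 2 * t + 2 ≤ x.val + k) := by
    rcases Nat.lt_or_ge (x.val + k) (2 * t + 2) with h | h
    · exact Or.inl ⟨Nat.mod_eq_of_lt h, h⟩
    · refine Or.inr ⟨?_, h⟩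
      rw [Nat.mod_eq_sub_mod h, Nat.mod_eq_of_lt (by omega)]
  rw [hv]
  generalize (x.val + k) % (2 * t + 2) = q at *
  rw [h1 _ _ hx (by omega) (by omega)]
  omega

/-- A doubly lexical ordering of a strongly chordal graph is a strong elimination ordering. -/
theorem gamma_free {V : Type*} [LinearOrder V] [Finite V] (G : SimpleGraph V)
    (hG : G.StronglyChordal)
    (hlex : ∀ x y l : V, x < y → N G x l → ¬ N G y l →
      ∃ d, l < d ∧ N G y d ∧ ¬ N G x d ∧ ∀ z, d < z → (N G x z ↔ N G y z))
    (i j k l : V) (hij : i < j) (hkl : k < l) (hik : N G i k) (hil : N G i l) (hjk : N G j k) :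
    N G j l := by
  classical
  by_contra hjl
  have hD : ∀ x y l : V, ∃ d, x < y → N G x l → ¬ N G y l →
      l < d ∧ N G y d ∧ ¬ N G x d ∧ ∀ z, d < z → (N G x z ↔ N G y z) := by
    intro x y l
    by_cases h : x < y ∧ N G x l ∧ ¬ N G y l
    · obtain ⟨d, hd⟩ := hlex x y l h.1 h.2.1 h.2.2
      exact ⟨d, fun _ _ _ => hd⟩
    · exact ⟨l, fun h1 h2 h3 => absurd ⟨h1, h2, h3⟩ h⟩
  choose D hD using hD
  obtain ⟨r, c, hr0, hr1, hc0, hc1, hr, hc⟩ : ∃ r c : ℕ → V, r 0 = i ∧ r 1 = j ∧ c 0 = k ∧ c 1 = l ∧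
      (∀ s, r (s + 2) = D (c s) (c (s + 1)) (r (s + 1))) ∧
      (∀ s, c (s + 2) = D (r s) (r (s + 1)) (c (s + 1))) := by
    let S : ℕ → V × V × V × V := fun n => Nat.rec (i, j, k, l)
      (fun _ p => (p.2.1, D p.2.2.1 p.2.2.2 p.2.1, p.2.2.2, D p.1 p.2.1 p.2.2.2)) n
    refine ⟨fun n => (S n).1, fun n => (S n).2.2.1, rfl, rfl, rfl, rfl, fun s => rfl, fun s => rfl⟩
  have inv : ∀ s : ℕ,
      (∀ i j, i ≤ s + 1 → j ≤ s + 1 →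
        (N G (r i) (c j) ↔ (i = 0 ∧ j = 0) ∨ i = j + 1 ∨ j = i + 1)) ∧
      (∀ i, i < s + 1 → r i < r (i + 1) ∧ c i < c (i + 1)) ∧
      (∀ i, i + 2 ≤ s + 1 → (∀ z, c (i + 2) < z → (N G (r i) z ↔ N G (r (i + 1)) z)) ∧
        (∀ z, r (i + 2) < z → (N G (c i) z ↔ N G (c (i + 1)) z))) := by
    intro s
    induction s with
    | zero =>
      refine ⟨?_, ?_, ?_⟩
      · intro p q hp hq
        have hp' : p = 0 ∨ p = 1 := by omega
        have hq' : q = 0 ∨ q = 1 := by omega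
        rcases hp' with rfl | rfl <;> rcases hq' with rfl | rfl <;>
          simp [hr0, hr1, hc0, hc1, hik, hil, hjk, hjl]
      · intro p hp
        have hp' : p = 0 := by omega
        subst hp'
        simp [hr0, hr1, hc0, hc1, hij, hkl]
      · intro p hp
        omega
    | succ s ih =>
      obtain ⟨P1, P2, P3⟩ := ih
      have hcs := hD (r s) (r (s + 1)) (c (s + 1)) (P2 s (by omega)).1
        ((P1 s (s + 1) (by omega) (by omega)).2 (by omega))
        (fun h => by
          have := (P1 (s + 1) (s + 1) (by omega) (by omega)).1 h
          omega)
      have hrs := hD (c s) (c (s + 1)) (r (s + 1)) (P2 s (by omega)).2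
        (N_symm ((P1 (s + 1) s (by omega) (by omega)).2 (by omega)))
        (fun h => by
          have := (P1 (s + 1) (s + 1) (by omega) (by omega)).1 (N_symm h)
          omega)
      rw [← hc] at hcs
      rw [← hr] at hrs
      obtain ⟨hc1', hc2, hc3, hc4⟩ := hcs
      obtain ⟨hr1', hr2, hr3, hr4⟩ := hrs
      have hmono : ∀ q, q ≤ s + 1 → ∀ p, p ≤ q → r p ≤ r q ∧ c p ≤ c q := by
        intro q
        induction q with
        | zero =>
          intro _ p hp
          have : p = 0 := by omega
          subst this; exact ⟨le_rfl, le_rfl⟩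
        | succ q ihq =>
          intro hq p hp
          rcases Nat.lt_or_ge p (q + 1) with h | h
          · have h1 := ihq (by omega) p (by omega)
            have h2 := P2 q (by omega)
            exact ⟨h1.1.trans h2.1.le, h1.2.trans h2.2.le⟩
          · have : p = q + 1 := by omega
            subst this; exact ⟨le_rfl, le_rfl⟩
      have hcol : ∀ d p, p + d = s → ¬ N G (r p) (c (s + 2)) ∧ ¬ N G (c p) (r (s + 2)) := by
        intro d
        induction d with
        | zero =>
          intro p hp
          have : p = s := by omega
          subst this
          exact ⟨hc3, hr3⟩
        | succ d ihd =>
          intro p hp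
          have h1 := ihd (p + 1) (by omega)
          have h2 := P3 p (by omega)
          have h3 := hmono (s + 1) le_rfl (p + 2) (by omega)
          rw [h2.1 _ (lt_of_le_of_lt h3.2 hc1'), h2.2 _ (lt_of_le_of_lt h3.1 hr1')]
          exact h1
      have hpre : ∀ p q, p ≤ s + 2 → q ≤ s + 2 → ¬ (p = s + 2 ∧ q = s + 2) →
          (N G (r p) (c q) ↔ (p = 0 ∧ q = 0) ∨ p = q + 1 ∨ q = p + 1) := by
        intro p q hp hq hpq
        rcases Nat.lt_or_ge p (s + 2) with h1 | h1
        · rcases Nat.lt_or_ge q (s + 2) with h2 | h2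
          · exact P1 p q (by omega) (by omega)
          · have : q = s + 2 := by omega
            subst this
            rcases Nat.lt_or_ge p (s + 1) with h3 | h3
            · exact iff_of_false (hcol (s - p) p (by omega)).1 (by omega)
            · have : p = s + 1 := by omega
              subst this
              exact iff_of_true hc2 (by omega)
        · have : p = s + 2 := by omega
          subst this
          rcases Nat.lt_or_ge q (s + 1) with h3 | h3
          · rw [N_comm]
            exact iff_of_false (hcol (s - q) q (by omega)).2 (by omega)
          · have : q = s + 1 := by omega
            subst this
            exact iff_of_true (N_symm hr2) (by omega)
      have hlast : ¬ N G (r (s + 2)) (c (s + 2)) := by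
        intro hN
        refine no_ladder G hG (s + 2) (by omega) r c ?_
        intro p q hp hq
        by_cases h : p = s + 2 ∧ q = s + 2
        · rw [h.1, h.2]
          exact iff_of_true hN (by omega)
        · rw [hpre p q hp hq h]; omega
      refine ⟨?_, ?_, ?_⟩
      · intro p q hp hq
        by_cases h : p = s + 2 ∧ q = s + 2
        · rw [h.1, h.2]
          exact iff_of_false hlast (by omega)
        · exact hpre p q hp hq h
      · intro p hp
        rcases Nat.lt_or_ge p (s + 1) with h | h
        · exact P2 p h
        · have : p = s + 1 := by omega
          subst this
          exact ⟨hr1', hc1'⟩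
      · intro p hp
        rcases Nat.lt_or_ge p s with h | h
        · exact P3 p (by omega)
        · have : p = s := by omega
          subst this
          exact ⟨hc4, hr4⟩
  have hsm : StrictMono r := strictMono_nat_of_lt_succ fun n => ((inv n).2.1 n (by omega)).1
  exact not_injective_infinite_finite r hsm.injective

theorem exists_lex {V : Type*} [Fintype V] (G : SimpleGraph V) :
    ∃ σ : V ≃ Fin (Fintype.card V), ∀ x y l : V, σ x < σ y → N G x l → ¬ N G y l →
      ∃ d, σ l < σ d ∧ N G y d ∧ ¬ N G x d ∧ ∀ z, σ d < σ z → (N G x z ↔ N G y z) := by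
  classical
  let m : V → V → ℤ := fun x y => if N G x y then 1 else 0
  have msymm : ∀ x y, m x y = m y x := by
    intro x y; simp only [m]; simp only [N_comm (x := x)]
  have mdiag : ∀ x, m x x = 1 := by intro x; simp [m, N_refl]
  have mle : ∀ x y, m x y ≤ 1 := by intro x y; simp only [m]; split_ifs <;> norm_num
  let Q : (V → ℤ) → ℤ := fun w => ∑ x, w x * ∑ y, m x y * w y
  have : Nonempty (V ≃ Fin (Fintype.card V)) := ⟨Fintype.equivFin V⟩
  obtain ⟨σ, hσ⟩ := Finite.exists_max
    (fun σ : V ≃ Fin (Fintype.card V) => Q (fun x => 2 ^ (σ x : ℕ)))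
  let w : V → ℤ := fun x => 2 ^ (σ x : ℕ)
  have hR : ∀ a b, σ a < σ b → ∑ y, m a y * w y ≤ ∑ y, m b y * w y := by
    intro a b hab
    by_contra hlt
    push Not at hlt
    have hne : a ≠ b := fun h => by rw [h] at hab; exact lt_irrefl _ hab
    have hδ : 0 < w b - w a := by
      have : w a < w b := by
        simp only [w]
        exact pow_lt_pow_right₀ (by norm_num) hab
      linarith
    have h1 := hσ ((Equiv.swap a b).trans σ)
    set δ := w b - w a with hδd
    let e : V → ℤ := fun x => (if x = a then 1 else 0) - (if x = b then 1 else 0)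
    have he : ∀ f : V → ℤ, ∑ x, f x * e x = f a - f b := by
      intro f
      simp [e, mul_sub, Finset.sum_sub_distrib]
    have hw' : (fun x => (2 : ℤ) ^ (((Equiv.swap a b).trans σ) x : ℕ)) = fun x => w x + δ * e x := by
      funext x
      simp only [Equiv.trans_apply]
      change w (Equiv.swap a b x) = _
      by_cases hxa : x = a
      · subst hxa; simp [e, hne, hδd]
      · by_cases hxb : x = b
        · subst hxb; simp [e, hδd, hxa]
        · simp [e, hxa, hxb, Equiv.swap_apply_of_ne_of_ne]
    rw [hw'] at h1
    change Q (fun x => w x + δ * e x) ≤ Q w at h1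
    have hin : ∀ x, ∑ y, m x y * (w y + δ * e y) = ∑ y, m x y * w y + δ * (m x a - m x b) := by
      intro x
      rw [← he (m x), Finset.mul_sum, ← Finset.sum_add_distrib]
      exact Finset.sum_congr rfl fun y _ => by ring
    have hRa : ∀ a, ∑ x, w x * m x a = ∑ y, m a y * w y := fun a =>
      Finset.sum_congr rfl fun y _ => by rw [msymm]; ring
    have hQ : Q (fun x => w x + δ * e x) = Q w + 2 * δ * (∑ y, m a y * w y - ∑ y, m b y * w y)
        + δ ^ 2 * (m a a + m b b - 2 * m a b) := by
      simp only [Q, hin]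
      have e1 : ∀ x, (w x + δ * e x) * (∑ y, m x y * w y + δ * (m x a - m x b)) =
          w x * ∑ y, m x y * w y + (δ * (w x * m x a) - δ * (w x * m x b)) +
          (δ * (∑ y, m x y * w y + δ * (m x a - m x b))) * e x := by intro x; ring
      simp only [e1]
      rw [Finset.sum_add_distrib, he, Finset.sum_add_distrib, Finset.sum_sub_distrib,
        ← Finset.mul_sum, ← Finset.mul_sum, hRa, hRa, msymm b a]
      ring
    rw [hQ, mdiag, mdiag] at h1
    have h2 : 0 ≤ δ ^ 2 * (1 + 1 - 2 * m a b) :=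
      mul_nonneg (sq_nonneg _) (by have := mle a b; linarith)
    have h3 : 0 < 2 * δ * (∑ y, m a y * w y - ∑ y, m b y * w y) :=
      mul_pos (by linarith) (by linarith)
    linarith
  let S : V → Finset ℕ := fun x => (Finset.univ.filter (N G x)).image (fun y => (σ y : ℕ))
  have hinjσ : Function.Injective (fun y => (σ y : ℕ)) := fun x y h => σ.injective (Fin.ext h)
  have hS : ∀ x y, (σ y : ℕ) ∈ S x ↔ N G x y := by
    intro x y
    simp only [S]
    rw [Finset.mem_image]
    constructor
    · rintro ⟨z, hz, hzy⟩
      rw [← hinjσ hzy]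
      exact (Finset.mem_filter.1 hz).2
    · intro h
      exact ⟨y, Finset.mem_filter.2 ⟨Finset.mem_univ _, h⟩, rfl⟩
  refine ⟨σ, fun x y l hxy hxl hyl => ?_⟩
  have hsum : ∀ x, ((∑ k ∈ S x, 2 ^ k : ℕ) : ℤ) = ∑ y, m x y * w y := by
    intro x
    simp only [S]
    rw [Finset.sum_image (fun a _ b _ h => hinjσ h), Finset.sum_filter]
    push_cast
    exact Finset.sum_congr rfl fun y _ => by simp [m, w]
  have hle : ∑ k ∈ S x, 2 ^ k ≤ ∑ k ∈ S y, 2 ^ k := by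
    have := hR x y hxy
    rw [← hsum, ← hsum] at this
    exact_mod_cast this
  have hne : S x ≠ S y := by
    intro h
    apply hyl
    rw [← hS, ← h, hS]; exact hxl
  rw [Finset.geomSum_le_geomSum_iff_toColex_le_toColex le_rfl] at hle
  have hlt : toColex (S x) < toColex (S y) := lt_of_le_of_ne hle (fun h => hne (by simpa using h))
  rw [Finset.Colex.lt_iff_exists_filter_lt] at hlt
  obtain ⟨d, hd, hf⟩ := hlt
  rw [Finset.mem_sdiff] at hd
  obtain ⟨hdy, hdx⟩ := hd
  obtain ⟨d, -, rfl⟩ := Finset.mem_image.1 hdy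
  rw [hS] at hdy hdx
  have hz : ∀ z, σ d < σ z → (N G x z ↔ N G y z) := by
    intro z hz
    have hz' : (σ d : ℕ) < (σ z : ℕ) := hz
    have := congrArg (fun s => (σ z : ℕ) ∈ s) hf
    simp only [Finset.mem_filter, hS, hz', and_true, eq_iff_iff] at this
    exact this
  refine ⟨d, ?_, hdy, hdx, hz⟩
  rcases lt_trichotomy (σ l) (σ d) with h | h | h
  · exact h
  · have := σ.injective h
    subst this
    exact absurd hxl hdx
  · exact absurd ((hz l h).1 hxl) hyl

end SCAux

/-- A finite simple graph is strongly chordal iff it admits a strong elimination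
ordering. -/
theorem stronglyChordal_iff_exists_strongElimOrdering {V : Type*} [Fintype V]
    (G : SimpleGraph V) :
    G.StronglyChordal ↔ ∃ σ : Fin (Fintype.card V) ≃ V, G.IsStrongElimOrdering σ := by
  constructor
  · intro hG
    obtain ⟨σ, hσ⟩ := SCAux.exists_lex G
    let _ : LinearOrder V := LinearOrder.lift' σ σ.injective
    refine ⟨σ.symm, fun i j k l hij hkl => ?_⟩
    simp only [SCAux.mem_closedNbhd]
    refine SCAux.gamma_free G hG hσ _ _ _ _ ?_ ?_
    · change σ (σ.symm i) < σ (σ.symm j); simpa using hij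
    · change σ (σ.symm k) < σ (σ.symm l); simpa using hkl
  · rintro ⟨σ, hσ⟩
    let _ : LinearOrder V := LinearOrder.lift' σ.symm σ.symm.injective
    refine SCAux.backward G fun i j k l hij hkl => ?_
    have := hσ (σ.symm i) (σ.symm j) (σ.symm k) (σ.symm l) hij hkl
    simpa only [SCAux.mem_closedNbhd, Equiv.apply_symm_apply] using this
end

section
/- A finite simple graph G is chordal if and only if every nonempty induced subgraph of G has a simplicial vertex. -/
namespace ChordalAux

theorem val_add_one {n : ℕ} (hn : 2 ≤ n) (i : ZMod n) :
    (i + 1).val = if i.val + 1 = n then 0 else i.val + 1 := by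
  have : NeZero n := ⟨by omega⟩
  have : Fact (1 < n) := ⟨by omega⟩
  have h := ZMod.val_lt i
  rw [ZMod.val_add, ZMod.val_one]
  split_ifs with h1
  · rw [h1, Nat.mod_self]
  · exact Nat.mod_eq_of_lt (by omega)

theorem not_chordal {V : Type*} (G : SimpleGraph V) (n : ℕ) (hn : 4 ≤ n) (q : ℕ → V)
    (hinj : ∀ i j, i < j → j < n → q i ≠ q j)
    (hadj : ∀ i, i + 1 < n → G.Adj (q i) (q (i + 1)))
    (hlast : G.Adj (q (n - 1)) (q 0))
    (hch : ∀ i j, i < j → j < n → G.Adj (q i) (q j) → j = i + 1 ∨ (i = 0 ∧ j = n - 1)) :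
    ¬ G.Chordal := by
  intro hG
  have : NeZero n := ⟨by omega⟩
  obtain ⟨i, j, h1, h2, h3⟩ := hG n hn (fun i => q i.val) ⟨by
    intro i j hij
    apply ZMod.val_injective n
    have hi := ZMod.val_lt i
    have hj := ZMod.val_lt j
    rcases lt_trichotomy i.val j.val with h | h | h
    · exact absurd hij (hinj _ _ h hj)
    · exact h
    · exact absurd hij.symm (hinj _ _ h hi), by
    intro i
    have hi := ZMod.val_lt i
    show G.Adj (q i.val) (q (i + 1).val)
    rw [val_add_one (by omega)]
    split_ifs with h
    · have : i.val = n - 1 := by omega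
      rw [this]; exact hlast
    · exact hadj _ (by omega)⟩
  have hi := ZMod.val_lt i
  have hj := ZMod.val_lt j
  have h2' : j.val ≠ (i + 1).val := fun h => h2 (ZMod.val_injective n h)
  have h3' : i.val ≠ (j + 1).val := fun h => h3 (ZMod.val_injective n h)
  rw [val_add_one (by omega)] at h2' h3'
  rcases lt_trichotomy i.val j.val with h | h | h
  · have := hch _ _ h hj h1
    split_ifs at h2' h3' <;> omega
  · have h1' : G.Adj (q i.val) (q j.val) := h1
    rw [h] at h1'
    exact G.loopless.irrefl _ h1'
  · have := hch _ _ h hi h1.symm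
    split_ifs at h2' h3' <;> omega

/-- The graph on `V` keeping only the edges inside `T`. -/
def keep {V : Type*} (G : SimpleGraph V) (T : Set V) : SimpleGraph V where
  Adj a b := G.Adj a b ∧ a ∈ T ∧ b ∈ T
  symm := ⟨fun _ _ h => ⟨h.1.symm, h.2.2, h.2.1⟩⟩
  loopless := ⟨fun _ h => G.loopless.irrefl _ h.1⟩

theorem reach_ind {V : Type*} {H : SimpleGraph V} {a b : V} (h : H.Reachable a b)
    {P : V → Prop} (h0 : P a) (hs : ∀ u w, H.Reachable a u → P u → H.Adj u w → P w) : P b := by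
  rw [SimpleGraph.reachable_iff_reflTransGen] at h
  induction h with
  | refl => exact h0
  | tail h1 h2 ih =>
    exact hs _ _ ((SimpleGraph.reachable_iff_reflTransGen _ _).2 h1) ih h2

theorem keep_mem {V : Type*} {G : SimpleGraph V} {T : Set V} {a b : V}
    (h : (keep G T).Reachable a b) (ha : a ∈ T) : b ∈ T :=
  reach_ind h ha (fun _ _ _ _ h => h.2.2)

theorem geodesic {V : Type*} {H : SimpleGraph V} {x y : V} (h : H.Reachable x y) :
    ∃ (m : ℕ) (p : ℕ → V), p 0 = x ∧ p m = y ∧ (∀ i < m, H.Adj (p i) (p (i + 1))) ∧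
      (∀ i, H.Reachable x (p i)) ∧ ∀ i ≤ m, H.dist x (p i) = i := by
  obtain ⟨w, hw⟩ := h.exists_walk_length_eq_dist
  refine ⟨w.length, w.getVert, by simp, by simp, fun i hi => w.adj_getVert_succ hi,
    fun i => ⟨w.take i⟩, fun i hi => ?_⟩
  have h1 : H.dist x (w.getVert i) ≤ i := by
    refine (SimpleGraph.dist_le (w.take i)).trans ?_
    simp [SimpleGraph.Walk.take_length]
  have h2 : H.dist (w.getVert i) y ≤ w.length - i := by
    refine (SimpleGraph.dist_le (w.drop i)).trans ?_
    simp [SimpleGraph.Walk.drop_length]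
  have h3 : H.dist x y ≤ H.dist x (w.getVert i) + H.dist (w.getVert i) y :=
    SimpleGraph.Reachable.dist_triangle_left ⟨w.take i⟩ y
  omega

/-- Two vertices adjacent to a connected set `C` avoiding `N[v]`, both adjacent to `v`,
are adjacent. -/
theorem sep_clique {V : Type*} {G : SimpleGraph V} (hG : G.Chordal) {C : Set V} {v x y : V}
    (hC : ∀ a ∈ C, ∀ b ∈ C, (keep G C).Reachable a b)
    (hvC : ∀ a ∈ C, a ≠ v ∧ ¬ G.Adj v a) (hx : G.Adj v x) (hy : G.Adj v y) (hxy : x ≠ y)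
    {a b : V} (ha : a ∈ C) (hb : b ∈ C) (hxa : G.Adj x a) (hyb : G.Adj y b) : G.Adj x y := by
  by_contra hnadj
  set T : Set V := C ∪ {x, y} with hT
  have hCT : C ⊆ T := Set.subset_union_left
  have hxT : x ∈ T := by simp [hT]
  have hyT : y ∈ T := by simp [hT]
  have hmono : keep G C ≤ keep G T := fun _ _ h => ⟨h.1, hCT h.2.1, hCT h.2.2⟩
  have hr : (keep G T).Reachable x y := by
    have e1 : (keep G T).Adj x a := ⟨hxa, hxT, hCT ha⟩
    have e2 : (keep G T).Adj b y := ⟨hyb.symm, hCT hb, hyT⟩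
    exact e1.reachable.trans (((hC a ha b hb).mono hmono).trans e2.reachable)
  obtain ⟨m, p, h0, hm, hp, hpr, hd⟩ := geodesic hr
  have hpT : ∀ i, p i ∈ T := fun i => keep_mem (hpr i) hxT
  have hinj : ∀ i j, i < j → j ≤ m → p i ≠ p j := by
    intro i j hij hj he
    have := hd i (by omega)
    have := hd j hj
    rw [← he] at this
    omega
  have hch : ∀ i j, i < j → j ≤ m → G.Adj (p i) (p j) → j = i + 1 := by
    intro i j hij hj he
    have e : (keep G T).Adj (p i) (p j) := ⟨he, hpT i, hpT j⟩
    have h3 := SimpleGraph.Reachable.dist_triangle_left (hpr i) (p j)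
    rw [hd i (by omega), hd j hj, SimpleGraph.dist_eq_one_iff_adj.2 e] at h3
    omega
  have hpC : ∀ i, 0 < i → i < m → p i ∈ C := by
    intro i hi him
    rcases hpT i with h | h | h
    · exact h
    · exact absurd (h0.trans h.symm) (hinj 0 i hi him.le)
    · exact absurd (h.trans hm.symm) (hinj i m him le_rfl)
  have hm2 : 2 ≤ m := by
    by_contra hlt
    have : m = 0 ∨ m = 1 := by omega
    rcases this with rfl | rfl
    · exact hxy (h0.symm.trans hm)
    · have := (hp 0 (by omega)).1
      rw [h0, hm] at this
      exact hnadj this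
  have hpv : ∀ i ≤ m, p i ≠ v := by
    intro i hi
    by_cases h : i = 0
    · rw [h, h0]; exact hx.ne'
    by_cases h' : i = m
    · rw [h', hm]; exact hy.ne'
    exact (hvC _ (hpC i (by omega) (by omega))).1
  refine not_chordal G (m + 2) (by omega) (fun i => if i ≤ m then p i else v) ?_ ?_ ?_ ?_ hG
  · intro i j hij hj
    have hi : i ≤ m := by omega
    simp only [hi, if_true]
    split_ifs with h
    · exact hinj i j hij h
    · exact hpv i hi
  · intro i hi
    have hi : i ≤ m := by omega
    simp only [hi, if_true]
    split_ifs with h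
    · exact (hp i (by omega)).1
    · have : i = m := by omega
      rw [this, hm]; exact hy.symm
  · have : ¬ (m + 2 - 1 ≤ m) := by omega
    simp only [this, if_false, Nat.zero_le, if_true, h0]
    exact hx
  · intro i j hij hj
    have hi : i ≤ m := by omega
    simp only [hi, if_true]
    split_ifs with h
    · exact fun e => Or.inl (hch i j hij h e)
    · intro e
      by_cases h1 : i = 0
      · right; omega
      by_cases h2 : i = m
      · left; omega
      exact absurd e.symm (hvC _ (hpC i (by omega) (by omega))).2

/-- `w` is simplicial in the subgraph induced by `S`. -/
def SimpIn {V : Type*} (G : SimpleGraph V) (S : Set V) (w : V) : Prop :=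
  ∀ a ∈ S, ∀ b ∈ S, G.Adj w a → G.Adj w b → a ≠ b → G.Adj a b

theorem main {V : Type*} [Finite V] {G : SimpleGraph V} (hG : G.Chordal) (k : ℕ) :
    ∀ S : Set V, S.ncard = k → ∀ v ∈ S, (∃ u ∈ S, u ≠ v ∧ ¬ G.Adj v u) →
      ∃ w ∈ S, w ≠ v ∧ ¬ G.Adj v w ∧ SimpIn G S w := by
  induction k using Nat.strong_induction_on with
  | _ k ih =>
  rintro S hS v hv ⟨w0, hw0S, hw0v, hw0⟩
  set W : Set V := {u | u ∈ S ∧ u ≠ v ∧ ¬ G.Adj v u} with hW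
  have hw0W : w0 ∈ W := ⟨hw0S, hw0v, hw0⟩
  set C : Set V := {u | (keep G W).Reachable w0 u} with hCdef
  have hw0C : w0 ∈ C := SimpleGraph.Reachable.refl _
  have hCW : C ⊆ W := fun u hu => keep_mem hu hw0W
  have hcl : ∀ c ∈ C, ∀ u ∈ W, G.Adj c u → u ∈ C := by
    intro c hc u hu e
    have e' : (keep G W).Adj c u := ⟨e, hCW hc, hu⟩
    exact SimpleGraph.Reachable.trans hc e'.reachable
  have hC0 : ∀ c ∈ C, (keep G C).Reachable w0 c := by
    intro c hc
    refine reach_ind (P := fun c => (keep G C).Reachable w0 c) hc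
      (SimpleGraph.Reachable.refl _) ?_
    intro u w hu hPu e
    have e' : (keep G C).Adj u w := ⟨e.1, hu, hcl u hu w e.2.2 e.1⟩
    exact hPu.trans e'.reachable
  have hCC : ∀ a ∈ C, ∀ b ∈ C, (keep G C).Reachable a b :=
    fun a ha b hb => (hC0 a ha).symm.trans (hC0 b hb)
  set N : Set V := {u | u ∈ S ∧ G.Adj v u ∧ ∃ c ∈ C, G.Adj u c} with hN
  have hNcl : ∀ x ∈ N, ∀ y ∈ N, x ≠ y → G.Adj x y := by
    rintro x ⟨-, hx, a, ha, hxa⟩ y ⟨-, hy, b, hb, hyb⟩ hxy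
    exact sep_clique hG hCC (fun a ha => (hCW ha).2) hx hy hxy ha hb hxa hyb
  have hnb : ∀ c ∈ C, ∀ u ∈ S, G.Adj c u → u ∈ C ∪ N := by
    intro c hc u hu e
    by_cases h : G.Adj v u
    · exact Or.inr ⟨hu, h, c, hc, e.symm⟩
    · refine Or.inl (hcl c hc u ⟨hu, ?_, h⟩ e)
      rintro rfl
      exact (hCW hc).2.2 e.symm
  have hsub : C ∪ N ⊆ S := by
    rintro u (h | h)
    · exact (hCW h).1
    · exact h.1
  have hvn : v ∉ C ∪ N := by
    rintro (h | h)
    · exact (hCW h).2.1 rfl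
    · exact G.loopless.irrefl _ h.2.1
  have hlt : (C ∪ N).ncard < k := by
    rw [← hS]
    exact Set.ncard_lt_ncard ⟨hsub, fun h => hvn (h hv)⟩ (Set.toFinite _)
  -- it suffices to find a simplicial vertex of `C ∪ N` in `C`
  suffices h : ∃ w ∈ C, SimpIn G (C ∪ N) w by
    obtain ⟨w, hw, hs⟩ := h
    refine ⟨w, (hCW hw).1, (hCW hw).2.1, (hCW hw).2.2, ?_⟩
    intro a ha b hb ea eb hab
    exact hs a (hnb w hw a ha ea) b (hnb w hw b hb eb) ea eb hab
  by_cases h1 : ∃ x ∈ N, ∃ u ∈ C ∪ N, u ≠ x ∧ ¬ G.Adj x u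
  · obtain ⟨x, hx, hu⟩ := h1
    obtain ⟨w, hw, hwx, hxw, hs⟩ := ih _ hlt _ rfl x (Or.inr hx) hu
    rcases hw with hw | hw
    · exact ⟨w, hw, hs⟩
    · exact absurd (hNcl x hx w hw hwx.symm) hxw
  by_cases h2 : ∃ x ∈ C, ∃ u ∈ C ∪ N, u ≠ x ∧ ¬ G.Adj x u
  · obtain ⟨x, hx, hu⟩ := h2
    obtain ⟨w, hw, hwx, hxw, hs⟩ := ih _ hlt _ rfl x (Or.inl hx) hu
    rcases hw with hw | hw
    · exact ⟨w, hw, hs⟩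
    · exact absurd ⟨w, hw, x, Or.inl hx, hwx.symm, fun e => hxw e.symm⟩ h1
  · push Not at h1 h2
    refine ⟨w0, hw0C, ?_⟩
    rintro a (ha | ha) b hb - - hab
    · exact h2 a ha b hb hab.symm
    · exact h1 a ha b hb hab.symm

end ChordalAux

/-- A finite simple graph is chordal iff every nonempty induced subgraph has a
simplicial vertex. -/
theorem chordal_iff_induced_simplicial {V : Type*} [Fintype V] (G : SimpleGraph V) :
    G.Chordal ↔ ∀ S : Set V, S.Nonempty → ∃ v : S, (G.induce S).IsSimplicialVertex v := by
  constructor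
  · rintro hG S ⟨s, hs⟩
    suffices h : ∃ w ∈ S, ChordalAux.SimpIn G S w by
      obtain ⟨w, hw, h⟩ := h
      refine ⟨⟨w, hw⟩, ?_⟩
      rintro ⟨a, ha⟩ ⟨b, hb⟩ ea eb hab
      exact h a ha b hb ea eb (fun e => hab (Subtype.ext e))
    by_cases h : ∃ x ∈ S, ∃ u ∈ S, u ≠ x ∧ ¬ G.Adj x u
    · obtain ⟨x, hx, hu⟩ := h
      obtain ⟨w, hw, -, -, h⟩ := ChordalAux.main hG _ S rfl x hx hu
      exact ⟨w, hw, h⟩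
    · push Not at h
      exact ⟨s, hs, fun a ha b hb _ _ hab => h a ha b hb hab.symm⟩
  · rintro h n hn f ⟨hinj, hadj⟩
    obtain ⟨⟨_, i, rfl⟩, hi⟩ := h (Set.range f) ⟨f 0, 0, rfl⟩
    have hk : ∀ k : ℕ, 0 < k → k < n → (k : ZMod n) ≠ 0 := by
      intro k h0 hk e
      rw [ZMod.natCast_eq_zero_iff] at e
      exact absurd (Nat.le_of_dvd h0 e) (by omega)
    have k1 := hk 1 (by omega) (by omega)
    have k2 := hk 2 (by omega) (by omega)
    have k3 := hk 3 (by omega) (by omega)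
    push_cast at k1 k2 k3
    have a1 : G.Adj (f i) (f (i - 1)) := by
      have := hadj (i - 1)
      rw [sub_add_cancel] at this
      exact this.symm
    have hne : i - 1 ≠ i + 1 := fun e => k2 (by linear_combination -e)
    refine ⟨i - 1, i + 1, ?_, fun e => k1 (by linear_combination e),
      fun e => k3 (by linear_combination -e)⟩
    exact hi ⟨_, i - 1, rfl⟩ ⟨_, i + 1, rfl⟩ a1 (hadj i)
      (fun e => hne (hinj (congrArg Subtype.val e)))
end

section
/- A finite simple graph G is strongly chordal if and only if every nonempty induced subgraph of G has a simple vertex. -/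
namespace SCProof

/-- Weak adjacency: equal or adjacent. -/
def W {V : Type*} (G : SimpleGraph V) (x y : V) : Prop := x = y ∨ G.Adj x y

lemma W.symm {V : Type*} {G : SimpleGraph V} {x y : V} (h : W G x y) : W G y x := by
  rcases h with h | h
  · exact Or.inl h.symm
  · exact Or.inr h.symm

lemma W_comm {V : Type*} {G : SimpleGraph V} {x y : V} : W G x y ↔ W G y x :=
  ⟨W.symm, W.symm⟩

lemma mem_closedNbhd {V : Type*} {G : SimpleGraph V} {x y : V} :
    y ∈ G.closedNbhd x ↔ W G x y := by
  unfold SimpleGraph.closedNbhd W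
  simp only [Set.mem_insert_iff, SimpleGraph.mem_neighborSet]
  constructor
  · rintro (h | h)
    · exact Or.inl h.symm
    · exact Or.inr h
  · rintro (h | h)
    · exact Or.inl h.symm
    · exact Or.inr h

lemma val_succ {n : ℕ} (hn : 2 ≤ n) (z : ZMod n) :
    (z.val + 1 = n ∧ (z + 1).val = 0) ∨ (z.val + 1 < n ∧ (z + 1).val = z.val + 1) := by
  have : NeZero n := ⟨by omega⟩
  have : Fact (1 < n) := ⟨by omega⟩
  have h := ZMod.val_lt z
  rw [ZMod.val_add, ZMod.val_one]
  rcases Nat.lt_or_ge (z.val + 1) n with h1 | h1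
  · right; exact ⟨h1, Nat.mod_eq_of_lt h1⟩
  · left
    have h2 : z.val + 1 = n := by omega
    exact ⟨h2, by rw [h2, Nat.mod_self]⟩

lemma eq_succ_of_val {n : ℕ} (hn : 2 ≤ n) (z w : ZMod n)
    (h : w.val = z.val + 1 ∨ (z.val + 1 = n ∧ w.val = 0)) : w = z + 1 := by
  have : NeZero n := ⟨by omega⟩
  apply ZMod.val_injective n
  have h1 := val_succ hn z
  have h2 := ZMod.val_lt w
  omega

lemma no_walk {V : Type*} {G : SimpleGraph V} (hG : G.Chordal) {v a b : V}
    (hva : G.Adj v a) (hvb : G.Adj v b) (hab : ¬ W G a b) :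
    ∀ (l : ℕ) (g : ℕ → V), g 0 = a → g l = b → (∀ i < l, W G (g i) (g (i + 1))) →
      (∀ i, 0 < i → i < l → ¬ W G v (g i)) → False := by
  intro l
  induction l using Nat.strong_induction_on with
  | _ l ih =>
  intro g h0 hl hw hv
  by_cases hs : ∃ i d, 1 ≤ d ∧ i + 1 + d ≤ l ∧ W G (g i) (g (i + 1 + d))
  · obtain ⟨i, d, hd, hid, hW⟩ := hs
    refine ih (l - d) (by omega) (fun t => if t ≤ i then g t else g (t + d)) ?_ ?_ ?_ ?_
    · simp [h0]
    · have : ¬ (l - d ≤ i) := by omega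
      simp only [this, if_false]
      rw [show l - d + d = l by omega, hl]
    · intro t ht
      by_cases h1 : t + 1 ≤ i
      · have h2 : t ≤ i := by omega
        simp only [h1, h2, if_true]
        exact hw t (by omega)
      · by_cases h2 : t ≤ i
        · have h3 : t = i := by omega
          subst h3
          simp only [h1, le_refl, if_true, if_false]
          exact hW
        · simp only [h1, h2, if_false]
          have := hw (t + d) (by omega)
          rwa [show t + d + 1 = t + 1 + d by omega] at this
    · intro t h1 h2
      by_cases h3 : t ≤ i
      · simp only [h3, if_true]; exact hv t h1 (by omega)
      · simp only [h3, if_false]; exact hv (t + d) (by omega) (by omega)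
  · push Not at hs
    have hl2 : 2 ≤ l := by
      by_contra hlt
      have : l = 0 ∨ l = 1 := by omega
      rcases this with rfl | rfl
      · exact hab (Or.inl (h0 ▸ hl ▸ rfl))
      · apply hab; rw [← h0, ← hl]; exact hw 0 (by omega)
    have hfar : ∀ i j, i + 1 < j → j ≤ l → ¬ W G (g i) (g j) := by
      intro i j hij hj
      have := hs i (j - i - 1) (by omega) (by omega)
      rwa [show i + 1 + (j - i - 1) = j by omega] at this
    have hne1 : ∀ i < l, g i ≠ g (i + 1) := by
      intro i hi he
      by_cases h1 : i + 2 ≤ l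
      · apply hfar i (i + 2) (by omega) h1
        rw [he]; exact hw (i + 1) (by omega)
      · apply hfar (i - 1) (i + 1) (by omega) (by omega)
        rw [← he]
        have := hw (i - 1) (by omega)
        rwa [show i - 1 + 1 = i by omega] at this
    have hlt : ∀ i j, i < j → j ≤ l → g i ≠ g j := by
      intro i j hij hj he
      by_cases h1 : j = i + 1
      · subst h1; exact hne1 i (by omega) he
      · exact hfar i j (by omega) hj (Or.inl he)
    have hvne : ∀ i ≤ l, v ≠ g i := by
      intro i hi he
      by_cases h1 : i = 0
      · subst h1; rw [h0] at he; exact hva.ne he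
      · by_cases h2 : i = l
        · subst h2; rw [hl] at he; exact hvb.ne he
        · exact hv i (by omega) (by omega) (Or.inl he)
    have hn : 2 ≤ l + 2 := by omega
    let f : ZMod (l + 2) → V := fun z => if z.val = l + 1 then v else g z.val
    have hfv : ∀ z, z.val = l + 1 → f z = v := fun z h => by simp [f, h]
    have hfg : ∀ z, z.val ≠ l + 1 → f z = g z.val := fun z h => by simp [f, h]
    have hval : ∀ z : ZMod (l + 2), z.val < l + 2 := fun z => ZMod.val_lt z
    obtain ⟨i, j, hadj, hij, hji⟩ := hG (l + 2) (by omega) f (by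
      constructor
      · intro i j he
        apply ZMod.val_injective (l + 2)
        have hi := hval i
        have hj := hval j
        by_cases h1 : i.val = l + 1 <;> by_cases h2 : j.val = l + 1
        · omega
        · rw [hfv i h1, hfg j h2] at he
          exact absurd he (hvne _ (by omega))
        · rw [hfg i h1, hfv j h2] at he
          exact absurd he.symm (hvne _ (by omega))
        · rw [hfg i h1, hfg j h2] at he
          rcases lt_trichotomy i.val j.val with h | h | h
          · exact absurd he (hlt _ _ h (by omega))
          · exact h
          · exact absurd he.symm (hlt _ _ h (by omega))
      · intro i
        have hi := hval i
        rcases val_succ hn i with ⟨h1, h2⟩ | ⟨h1, h2⟩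
        · rw [hfv i (by omega), hfg (i + 1) (by omega), h2, h0]; exact hva
        · by_cases h3 : i.val = l
          · rw [hfg i (by omega), hfv (i + 1) (by omega), h3, hl]; exact hvb.symm
          · rw [hfg i (by omega), hfg (i + 1) (by omega), h2]
            rcases hw i.val (by omega) with h | h
            · exact absurd h (hne1 _ (by omega))
            · exact h)
    have hi := hval i
    have hj := hval j
    have key : ∀ i j : ZMod (l + 2), i.val < j.val → G.Adj (f i) (f j) → j ≠ i + 1 → i ≠ j + 1 →
        False := by
      intro i j hlt' hadj hij hji
      have hi := hval i
      have hj := hval j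
      have e1 : ¬ (j.val = i.val + 1) := fun h => hij (eq_succ_of_val hn i j (Or.inl h))
      have e2 : ¬ (j.val + 1 = l + 2 ∧ i.val = 0) :=
        fun h => hji (eq_succ_of_val hn j i (Or.inr h))
      by_cases h2 : j.val = l + 1
      · rw [hfg i (by omega), hfv j h2] at hadj
        exact hv i.val (by omega) (by omega) (Or.inr hadj.symm)
      · rw [hfg i (by omega), hfg j h2] at hadj
        exact hfar _ _ (by omega) (by omega) (Or.inr hadj)
    rcases lt_trichotomy i.val j.val with h | h | h
    · exact key i j h hadj hij hji
    · have := ZMod.val_injective _ h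
      subst this
      exact G.irrefl hadj
    · exact key j i h hadj.symm hji hij

lemma core {V : Type*} {G : SimpleGraph V} (hG : G.StronglyChordal) {n : ℕ} (hn : 6 ≤ n)
    (h2 : 2 ∣ n) (x : ZMod n → V) (H1 : ∀ a, W G (x a) (x (a + 1)))
    (H2 : ∀ a b, ZMod.castHom h2 (ZMod 2) a ≠ ZMod.castHom h2 (ZMod 2) b → W G (x a) (x b) →
      b = a + 1 ∨ a = b + 1) : False := by
  have : NeZero n := ⟨by omega⟩
  set p := ZMod.castHom h2 (ZMod 2) with hp
  have hsmall : ∀ m : ℕ, 0 < m → m < n → (m : ZMod n) ≠ 0 := by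
    intro m h0 hm h
    rw [ZMod.natCast_eq_zero_iff] at h
    exact absurd (Nat.le_of_dvd h0 h) (by omega)
  have c1 := hsmall 1 (by omega) (by omega)
  have c2 := hsmall 2 (by omega) (by omega)
  have c3 := hsmall 3 (by omega) (by omega)
  have c4 := hsmall 4 (by omega) (by omega)
  push_cast at c1 c2 c3 c4
  have hp1 : ∀ a, p (a + 1) ≠ p a := by
    intro a
    rw [map_add, map_one]
    generalize p a = u
    revert u; decide
  have hz2 : ∀ u v w : ZMod 2, u ≠ v → v ≠ w → u = w := by decide
  by_cases hinj : Function.Injective x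
  · obtain ⟨i, j, ⟨hadj, hij, hji⟩, hodd⟩ := hG.2 n hn (even_iff_two_dvd.2 h2) x ⟨hinj, fun i => by
      rcases H1 i with h | h
      · have := hinj h
        exact absurd (by linear_combination -this) c1
      · exact h⟩
    have : p i ≠ p j := by
      intro h
      have h3 : p (j - i) = 0 := by rw [map_sub, h, sub_self]
      rw [hp, ZMod.castHom_apply, ZMod.cast_eq_val, ZMod.natCast_eq_zero_iff_even] at h3
      exact (Nat.not_even_iff_odd.2 hodd) h3
    rcases H2 i j this (Or.inr hadj) with h | h
    · exact hij h
    · exact hji h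
  · -- same parity vertices are distinct
    have hsame : ∀ a b, p a = p b → x a = x b → a = b := by
      intro a b hpab hx
      have e1 := H2 b (a + 1) (by rw [← hpab]; exact (hp1 a).symm) (hx ▸ H1 a)
      have e2 := H2 (a - 1) b (by
        rw [← hpab]; have := hp1 (a - 1); rw [sub_add_cancel] at this; exact this.symm)
        (by have := H1 (a - 1); rw [sub_add_cancel, hx] at this; exact this)
      rcases e1 with e1 | e1
      · linear_combination e1
      · rcases e2 with e2 | e2
        · linear_combination -e2
        · exact absurd (by linear_combination -e1 - e2 : (4 : ZMod n) = 0) c4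
    have key : ∀ a, x a = x (a + 1) → False := by
      intro a hx
      have hc : ∀ t : ℕ, x (a + 2 + (t : ZMod n)) = x (a + ((2 + t : ℕ) : ZMod n)) := by
        intro t; congr 1; push_cast; ring
      have pa2 : p (a + 2) = p a := by
        have e1 := hp1 a
        have e2 := hp1 (a + 1)
        rw [show a + 1 + 1 = a + 2 by ring] at e2
        exact hz2 _ _ _ e2 e1
      have pam : p (a - 1) ≠ p a := by
        have := hp1 (a - 1); rw [sub_add_cancel] at this; exact this.symm
      have hn3 : ((n - 3 : ℕ) : ZMod n) = -3 := by
        rw [Nat.cast_sub (by omega)]; simp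
      have hva : G.Adj (x a) (x (a + 2)) := by
        have h := H1 (a + 1)
        rw [← hx, show a + 1 + 1 = a + 2 by ring] at h
        rcases h with h | h
        · exact absurd (by linear_combination -(hsame _ _ pa2.symm h)) c2
        · exact h
      have hvb : G.Adj (x a) (x (a - 1)) := by
        have h := H1 (a - 1)
        rw [sub_add_cancel] at h
        rcases h with h | h
        · rw [hx] at h
          have := hsame _ _ (hz2 _ _ _ pam (hp1 a).symm) h
          exact absurd (by linear_combination -this) c2
        · exact h.symm
      have hab : ¬ W G (x (a + 2)) (x (a - 1)) := by
        intro h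
        rcases H2 _ _ (by rw [pa2]; exact pam.symm) h with h | h
        · exact absurd (by linear_combination -h) c4
        · exact absurd (by linear_combination h) c2
      refine no_walk hG.1 hva hvb hab (n - 3) (fun t => x (a + 2 + (t : ZMod n))) ?_ ?_ ?_ ?_
      · simp
      · simp only [hn3]; congr 1; ring
      · intro i _
        have := H1 (a + 2 + (i : ZMod n))
        simpa [add_assoc] using this
      · intro t h0 ht hW
        by_cases hpar : p (a + 2 + (t : ZMod n)) = p a
        · skip
          rw [hx] at hW
          rcases H2 _ _ (by rw [hpar]; exact hp1 a) hW with h | h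
          · exact hsmall t h0 (by omega) (by linear_combination h)
          · exact hsmall (t + 2) (by omega) (by omega) (by push_cast; linear_combination -h)
        · rcases H2 _ _ (fun h => hpar h.symm) hW with h | h
          · exact hsmall (t + 1) (by omega) (by omega) (by push_cast; linear_combination h)
          · exact hsmall (t + 3) (by omega) (by omega) (by push_cast; linear_combination -h)
    apply hinj
    intro a b hx
    by_cases hpab : p a = p b
    · exact hsame a b hpab hx
    · exfalso
      rcases H2 a b hpab (Or.inl hx) with h | h
      · subst h; exact key a hx
      · subst h; exact key b hx.symm

/-- Forbidden cycle submatrix, in zigzag order. -/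
lemma no_zigzag {V : Type*} {G : SimpleGraph V} (hG : G.StronglyChordal) (k : ℕ) (hk : 3 ≤ k)
    (r c : ℕ → V)
    (h : ∀ i < k, ∀ j < k, (W G (r i) (c j) ↔
      (i = 0 ∧ j = 0) ∨ i = j + 1 ∨ j = i + 1 ∨ (i + 1 = k ∧ j + 1 = k))) : False := by
  have hn : 2 ≤ 2 * k := by omega
  have : NeZero (2 * k) := ⟨by omega⟩
  have hdiv : 2 ∣ 2 * k := ⟨k, rfl⟩
  let y : ℕ → V := fun m => if m % 2 = 0 then c (min m (2 * k - 1 - m)) else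
    r (min m (2 * k - 1 - m))
  have hy0 : ∀ m, m % 2 = 0 → y m = c (min m (2 * k - 1 - m)) := fun m h => by simp [y, h]
  have hy1 : ∀ m, m % 2 = 1 → y m = r (min m (2 * k - 1 - m)) := fun m h => by simp [y, h]
  have hy : ∀ m m', m < 2 * k → m' < 2 * k → m % 2 = 1 → m' % 2 = 0 → (W G (y m) (y m') ↔
      (m' = m + 1 ∨ m = m' + 1 ∨ (m + 1 = 2 * k ∧ m' = 0))) := by
    intro m m' hm hm' h1 h0
    rw [hy1 m h1, hy0 m' h0, h _ (by omega) _ (by omega)]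
    omega
  have hval : ∀ z : ZMod (2 * k), z.val < 2 * k := fun z => ZMod.val_lt z
  have hcast : ∀ z : ZMod (2 * k), ZMod.castHom hdiv (ZMod 2) z = ((z.val : ℕ) : ZMod 2) := by
    intro z; rw [ZMod.castHom_apply, ZMod.cast_eq_val]
  refine core hG (n := 2 * k) (by omega) hdiv (fun z => y z.val) ?_ ?_
  · intro a
    have ha := hval a
    have hs := val_succ hn a
    have ha' := hval (a + 1)
    by_cases hpar : a.val % 2 = 1
    · rw [hy _ _ ha ha' hpar (by omega)]; omega
    · rw [W_comm, hy _ _ ha' ha (by omega) (by omega)]; omega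
  · intro a b hpar hW
    have ha := hval a
    have hb := hval b
    rw [hcast, hcast, Ne, ZMod.natCast_eq_natCast_iff'] at hpar
    have : (b.val = a.val + 1 ∨ (a.val + 1 = 2 * k ∧ b.val = 0)) ∨
        (a.val = b.val + 1 ∨ (b.val + 1 = 2 * k ∧ a.val = 0)) := by
      by_cases hp : a.val % 2 = 1
      · rw [hy _ _ ha hb hp (by omega)] at hW; omega
      · rw [W_comm, hy _ _ hb ha (by omega) (by omega)] at hW; omega
    rcases this with h | h
    · exact Or.inl (eq_succ_of_val hn a b h)
    · exact Or.inr (eq_succ_of_val hn b a h)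


open Classical in
/-- weight of a row -/
noncomputable def rowWt {V : Type*} [Fintype V] (R : V → V → Prop)
    (τ : V ≃ Fin (Fintype.card V)) (a : V) : ℕ :=
  ∑ b : V, if R a b then 2 ^ (τ b : ℕ) else 0

/-- total weight of the matrix -/
noncomputable def totWt {V : Type*} [Fintype V] (R : V → V → Prop)
    (σ τ : V ≃ Fin (Fintype.card V)) : ℕ :=
  ∑ a : V, 2 ^ (σ a : ℕ) * rowWt R τ a

lemma totWt_comm {V : Type*} [Fintype V] (R : V → V → Prop) (hR : ∀ a b, R a b ↔ R b a)
    (σ τ : V ≃ Fin (Fintype.card V)) : totWt R σ τ = totWt R τ σ := by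
  classical
  unfold totWt rowWt
  simp only [Finset.mul_sum]
  rw [Finset.sum_comm]
  refine Finset.sum_congr rfl fun a _ => Finset.sum_congr rfl fun b _ => ?_
  by_cases h : R a b
  · have h' := (hR a b).1 h
    simp only [h, h', if_true]; ring
  · have h' : ¬ R b a := fun h' => h ((hR a b).2 h')
    simp only [h, h', if_false]; ring

lemma rowWt_le {V : Type*} [Fintype V] (R : V → V → Prop)
    (σ τ : V ≃ Fin (Fintype.card V)) (hmax : ∀ σ', totWt R σ' τ ≤ totWt R σ τ)
    (a a' : V) (h : σ a < σ a') : rowWt R τ a ≤ rowWt R τ a' := by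
  classical
  have hne : a ≠ a' := by rintro rfl; exact lt_irrefl _ h
  have h1 := hmax ((Equiv.swap a a').trans σ)
  unfold totWt at h1
  have h2 : (0 : ℤ) ≤ ∑ x : V, ((2 : ℤ) ^ (σ x : ℕ) - 2 ^ (σ (Equiv.swap a a' x) : ℕ)) *
      (rowWt R τ x : ℤ) := by
    simp only [sub_mul, Finset.sum_sub_distrib]
    have h3 : ((∑ x : V, 2 ^ (((Equiv.swap a a').trans σ) x : ℕ) * rowWt R τ x : ℕ) : ℤ) ≤
      ((∑ x : V, 2 ^ (σ x : ℕ) * rowWt R τ x : ℕ) : ℤ) := by exact_mod_cast h1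
    push_cast at h3
    simp only [Equiv.trans_apply] at h3
    linarith
  rw [Finset.sum_eq_add a a' hne (by
    intro c _ hc
    rw [Equiv.swap_apply_of_ne_of_ne hc.1 hc.2]; ring) (by simp) (by simp)] at h2
  rw [Equiv.swap_apply_left, Equiv.swap_apply_right] at h2
  have h4 : (2 : ℤ) ^ (σ a : ℕ) < 2 ^ (σ a' : ℕ) :=
    pow_lt_pow_right₀ (by norm_num) h
  have h5 : (rowWt R τ a : ℤ) ≤ rowWt R τ a' := by nlinarith
  exact_mod_cast h5

lemma lex_of_rowWt {V : Type*} [Fintype V] (R : V → V → Prop)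
    (τ : V ≃ Fin (Fintype.card V)) (a a' : V) (h : rowWt R τ a ≤ rowWt R τ a')
    (c : V) (hc : R a c) (hc' : ¬ R a' c) :
    ∃ t, ¬ R a t ∧ R a' t ∧ τ c < τ t ∧ ∀ s, τ t < τ s → (R a s ↔ R a' s) := by
  classical
  let e : V ↪ ℕ := ⟨fun b => (τ b : ℕ), fun x y hxy => τ.injective (Fin.ext hxy)⟩
  let F : V → Finset ℕ := fun u => (Finset.univ.filter (fun b => R u b)).map e
  have hF : ∀ u, rowWt R τ u = ∑ k ∈ F u, 2 ^ k := by
    intro u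
    simp only [F, Finset.sum_map, Finset.sum_filter, rowWt]
    rfl
  have hm : ∀ u b, (τ b : ℕ) ∈ F u ↔ R u b := by
    intro u b
    have : (τ b : ℕ) = e b := rfl
    rw [this]
    simp only [F, Finset.mem_map' e, Finset.mem_filter, Finset.mem_univ, true_and]
  have hm' : ∀ u k, k ∈ F u → ∃ b, (τ b : ℕ) = k := by
    intro u k hk
    simp only [F, Finset.mem_map] at hk
    obtain ⟨b, _, hb⟩ := hk
    exact ⟨b, hb⟩
  rw [hF, hF, Finset.geomSum_le_geomSum_iff_toColex_le_toColex le_rfl] at h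
  have hne : F a ≠ F a' := by
    intro he
    apply hc'
    rw [← hm, ← he, hm]; exact hc
  have hlt := lt_of_le_of_ne h (fun he => hne (by simpa using he))
  rw [Finset.Colex.lt_iff_exists_filter_lt] at hlt
  obtain ⟨w, hw, hfil⟩ := hlt
  rw [Finset.mem_sdiff] at hw
  obtain ⟨t, rfl⟩ := hm' a' w hw.1
  rw [hm, hm] at hw
  have hag : ∀ s, τ t < τ s → (R a s ↔ R a' s) := by
    intro s hs
    have := congrArg (fun S => (τ s : ℕ) ∈ S) hfil
    have hs' : (τ t : ℕ) < τ s := hs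
    simp only [Finset.mem_filter, hs', and_true, hm, eq_iff_iff] at this
    exact this
  refine ⟨t, hw.2, hw.1, ?_, hag⟩
  rcases lt_trichotomy (τ c) (τ t) with h1 | h1 | h1
  · exact h1
  · have := τ.injective h1
    subst this
    exact absurd hw.1 hc'
  · exact (hc' ((hag c h1).1 hc)).elim

/-- doubly lexical ordering -/
lemma exists_doubly_lex {V : Type*} [Fintype V] (R : V → V → Prop) (hR : ∀ a b, R a b ↔ R b a) :
    ∃ σ τ : V ≃ Fin (Fintype.card V),
      (∀ a a' c, σ a < σ a' → R a c → ¬ R a' c →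
        ∃ t, ¬ R a t ∧ R a' t ∧ τ c < τ t ∧ ∀ s, τ t < τ s → (R a s ↔ R a' s)) ∧
      (∀ a a' c, τ a < τ a' → R a c → ¬ R a' c →
        ∃ t, ¬ R a t ∧ R a' t ∧ σ c < σ t ∧ ∀ s, σ t < σ s → (R a s ↔ R a' s)) := by
  classical
  haveI : Nonempty (V ≃ Fin (Fintype.card V)) := ⟨Fintype.equivFin V⟩
  obtain ⟨⟨σ, τ⟩, hmax⟩ := Finite.exists_max
    (fun q : (V ≃ Fin (Fintype.card V)) × (V ≃ Fin (Fintype.card V)) => totWt R q.1 q.2)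
  refine ⟨σ, τ, ?_, ?_⟩
  · intro a a' c h h1 h2
    exact lex_of_rowWt R τ a a' (rowWt_le R σ τ (fun σ' => hmax (σ', τ)) a a' h) c h1 h2
  · intro a a' c h h1 h2
    refine lex_of_rowWt R σ a a' (rowWt_le R τ σ (fun ρ => ?_) a a' h) c h1 h2
    rw [totWt_comm R hR ρ σ, totWt_comm R hR τ σ]
    exact hmax (σ, ρ)

/-- Half of the inductive step -/
lemma half_step {V : Type*} {G : SimpleGraph V} {N : ℕ} (σ : V → Fin N)
    (r c : ℕ → V) (K : ℕ)
    (hσ : ∀ i < K + 1, σ (r i) < σ (r (i + 1)))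
    (hag : ∀ i, i + 2 ≤ K → ∀ s, σ (r (i + 2)) < σ s → (W G (c i) s ↔ W G (c (i + 1)) s))
    (h0 : ¬ W G (c (K - 1)) (r (K + 1))) : ∀ j, j + 1 ≤ K → ¬ W G (c j) (r (K + 1)) := by
  have hmono : ∀ d i, i + d ≤ K → σ (r i) < σ (r (i + d + 1)) := by
    intro d
    induction d with
    | zero => intro i hi; exact hσ i (by omega)
    | succ d ih =>
      intro i hi
      exact (ih i (by omega)).trans (hσ (i + d + 1) (by omega))
  have key : ∀ d j, j + 1 + d = K → ¬ W G (c j) (r (K + 1)) := by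
    intro d
    induction d with
    | zero => intro j hj; rwa [show j = K - 1 by omega]
    | succ d ih =>
      intro j hj
      rw [hag j (by omega) (r (K + 1)) (by
        have := hmono (K - (j + 2)) (j + 2) (by omega)
        rwa [show j + 2 + (K - (j + 2)) + 1 = K + 1 by omega] at this)]
      exact ih (j + 1) (by omega)
  intro j hj
  exact key (K - (j + 1)) j (by omega)

lemma exists_simple {V : Type*} [Fintype V] [Nonempty V] (G : SimpleGraph V)
    (hG : G.StronglyChordal) : ∃ v, G.IsSimpleVertex v := by
  classical
  obtain ⟨σ, τ, hrow, hcol⟩ := exists_doubly_lex (W G) (fun a b => W_comm)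
  -- next column from two rows, next row from two columns
  have hrow' : ∀ a a', ∃ t, ∀ c, σ a < σ a' → W G a c → ¬ W G a' c →
      (¬ W G a t ∧ W G a' t ∧ τ c < τ t ∧ ∀ s, τ t < τ s → (W G a s ↔ W G a' s)) := by
    intro a a'
    by_cases h : ∃ t, ¬ W G a t ∧ W G a' t ∧ ∀ s, τ t < τ s → (W G a s ↔ W G a' s)
    · obtain ⟨t, h1, h2, h3⟩ := h
      refine ⟨t, fun c _ hc hc' => ⟨h1, h2, ?_, h3⟩⟩
      by_contra hlt
      rcases (not_lt.1 hlt).lt_or_eq with h4 | h4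
      · exact hc' ((h3 c h4).1 hc)
      · rw [τ.injective h4] at h1; exact h1 hc
    · refine ⟨a, fun c h1 h2 h3 => ?_⟩
      obtain ⟨t, h4, h5, _, h6⟩ := hrow a a' c h1 h2 h3
      exact absurd ⟨t, h4, h5, h6⟩ h
  have hcol' : ∀ a a', ∃ t, ∀ c, τ a < τ a' → W G a c → ¬ W G a' c →
      (¬ W G a t ∧ W G a' t ∧ σ c < σ t ∧ ∀ s, σ t < σ s → (W G a s ↔ W G a' s)) := by
    intro a a'
    by_cases h : ∃ t, ¬ W G a t ∧ W G a' t ∧ ∀ s, σ t < σ s → (W G a s ↔ W G a' s)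
    · obtain ⟨t, h1, h2, h3⟩ := h
      refine ⟨t, fun c _ hc hc' => ⟨h1, h2, ?_, h3⟩⟩
      by_contra hlt
      rcases (not_lt.1 hlt).lt_or_eq with h4 | h4
      · exact hc' ((h3 c h4).1 hc)
      · rw [σ.injective h4] at h1; exact h1 hc
    · refine ⟨a, fun c h1 h2 h3 => ?_⟩
      obtain ⟨t, h4, h5, _, h6⟩ := hcol a a' c h1 h2 h3
      exact absurd ⟨t, h4, h5, h6⟩ h
  choose nc hnc using hrow'
  choose nr hnr using hcol'
  have noGamma : ∀ v s u w, σ v < σ s → τ u < τ w → W G v u → W G v w → W G s u → W G s w := by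
    intro v s u w hvs huw hvu hvw hsu
    by_contra hsw
    let st : ℕ → V × V × V × V := fun m => Nat.rec (v, s, u, w)
      (fun _ q => (q.2.1, nr q.2.2.1 q.2.2.2, q.2.2.2, nc q.1 q.2.1)) m
    let r : ℕ → V := fun m => (st m).1
    let c : ℕ → V := fun m => (st m).2.2.1
    have r0 : r 0 = v := rfl
    have r1 : r 1 = s := rfl
    have c0 : c 0 = u := rfl
    have c1 : c 1 = w := rfl
    have rs : ∀ m, r (m + 2) = nr (c m) (c (m + 1)) := fun m => rfl
    have cs : ∀ m, c (m + 2) = nc (r m) (r (m + 1)) := fun m => rfl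
    clear_value r c
    have inv : ∀ K, 1 ≤ K →
        (∀ i < K, σ (r i) < σ (r (i + 1))) ∧ (∀ i < K, τ (c i) < τ (c (i + 1))) ∧
        (∀ i ≤ K, ∀ j ≤ K, (W G (r i) (c j) ↔ (i = 0 ∧ j = 0) ∨ i = j + 1 ∨ j = i + 1)) ∧
        (∀ i, i + 2 ≤ K → ∀ s, σ (r (i + 2)) < σ s → (W G (c i) s ↔ W G (c (i + 1)) s)) ∧
        (∀ i, i + 2 ≤ K → ∀ s, τ (c (i + 2)) < τ s → (W G (r i) s ↔ W G (r (i + 1)) s)) := by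
      intro K hK
      induction K, hK using Nat.le_induction with
      | base =>
        refine ⟨?_, ?_, ?_, ?_, ?_⟩
        · intro i hi
          obtain rfl : i = 0 := by omega
          simpa [r0, r1] using hvs
        · intro i hi
          obtain rfl : i = 0 := by omega
          simpa [c0, c1] using huw
        · intro i hi j hj
          have hi' : i = 0 ∨ i = 1 := by omega
          have hj' : j = 0 ∨ j = 1 := by omega
          rcases hi' with rfl | rfl <;> rcases hj' with rfl | rfl <;>
            simp [r0, r1, c0, c1, *]
        · intro i hi; omega
        · intro i hi; omega
      | succ K hK ih =>
        obtain ⟨hσ, hτ, hW, hcag, hrag⟩ := ih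
        obtain ⟨k, rfl⟩ : ∃ k, K = k + 1 := ⟨K - 1, by omega⟩
        have e1 := hnr (c k) (c (k + 1)) (r (k + 1)) (hτ k (by omega))
          ((hW (k + 1) le_rfl k (by omega)).2 (by omega)).symm
          (fun h => absurd ((hW (k + 1) le_rfl (k + 1) le_rfl).1 h.symm) (by omega))
        have e2 := hnc (r k) (r (k + 1)) (c (k + 1)) (hσ k (by omega))
          ((hW k (by omega) (k + 1) le_rfl).2 (by omega))
          (fun h => absurd ((hW (k + 1) le_rfl (k + 1) le_rfl).1 h) (by omega))
        rw [← rs] at e1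
        rw [← cs] at e2
        have hσ' : ∀ i < k + 1 + 1, σ (r i) < σ (r (i + 1)) := by
          intro i hi
          by_cases h : i = k + 1
          · subst h; exact e1.2.2.1
          · exact hσ i (by omega)
        have hρ : ∀ i < k + 1 + 1, τ (c i) < τ (c (i + 1)) := by
          intro i hi
          by_cases h : i = k + 1
          · subst h; exact e2.2.2.1
          · exact hτ i (by omega)
        have f1 := half_step (G := G) σ r c (k + 1) hσ' hcag (by simpa using e1.1)
        have f2 := half_step (G := G) τ c r (k + 1) hρ hrag (by simpa using e2.1)
        -- all entries but the corner
        have ent : ∀ i ≤ k + 2, ∀ j ≤ k + 2, ¬ (i = k + 2 ∧ j = k + 2) →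
            (W G (r i) (c j) ↔ (i = 0 ∧ j = 0) ∨ i = j + 1 ∨ j = i + 1) := by
          intro i hi j hj hij
          by_cases hi2 : i = k + 2
          · subst hi2
            by_cases hj1 : j = k + 1
            · subst hj1
              exact iff_of_true e1.2.1.symm (by omega)
            · exact iff_of_false (fun h => f1 j (by omega) h.symm) (by omega)
          · by_cases hj2 : j = k + 2
            · subst hj2
              by_cases hi1 : i = k + 1
              · subst hi1
                exact iff_of_true e2.2.1 (by omega)
              · exact iff_of_false (fun h => f2 i (by omega) h) (by omega)
            · exact hW i (by omega) j (by omega)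
        have corner : ¬ W G (r (k + 2)) (c (k + 2)) := by
          intro hcor
          refine no_zigzag hG (k + 3) (by omega) r c ?_
          intro i hi j hj
          by_cases hij : i = k + 2 ∧ j = k + 2
          · obtain ⟨rfl, rfl⟩ := hij
            exact iff_of_true hcor (by omega)
          · rw [ent i (by omega) j (by omega) hij]; omega
        refine ⟨hσ', hρ, ?_, ?_, ?_⟩
        · intro i hi j hj
          by_cases hij : i = k + 2 ∧ j = k + 2
          · obtain ⟨rfl, rfl⟩ := hij
            exact iff_of_false corner (by omega)
          · exact ent i hi j hj hij
        · intro i hi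
          by_cases h : i = k
          · subst h; exact e1.2.2.2
          · exact hcag i (by omega)
        · intro i hi
          by_cases h : i = k
          · subst h; exact e2.2.2.2
          · exact hrag i (by omega)
    have hmono : StrictMono (fun m => σ (r m)) :=
      strictMono_nat_of_lt_succ fun m => (inv (m + 1) (by omega)).1 m (by omega)
    exact not_injective_infinite_finite _ hmono.injective
  have hpos : 0 < Fintype.card V := Fintype.card_pos
  refine ⟨σ.symm ⟨0, hpos⟩, ?_⟩
  have main : ∀ u w, W G (σ.symm ⟨0, hpos⟩) u → W G (σ.symm ⟨0, hpos⟩) w → τ u < τ w →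
      G.closedNbhd u ⊆ G.closedNbhd w := by
    intro u w hu hw huw s hs
    rw [mem_closedNbhd] at hs ⊢
    by_cases h : s = σ.symm ⟨0, hpos⟩
    · subst h; exact hw.symm
    · refine (noGamma _ s u w ?_ huw hu hw hs.symm).symm
      rw [Equiv.apply_symm_apply, Fin.lt_def]
      rcases Nat.eq_zero_or_pos (σ s : ℕ) with h1 | h1
      · exact absurd ((Equiv.eq_symm_apply σ).2 (Fin.ext h1)) h
      · exact h1
  intro u w hu hw
  rw [mem_closedNbhd] at hu hw
  rcases lt_trichotomy (τ u) (τ w) with h | h | h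
  · exact Or.inl (main u w hu hw h)
  · rw [τ.injective h]; exact Or.inl subset_rfl
  · exact Or.inr (main w u hw hu h)

lemma stronglyChordal_induce {V : Type*} {G : SimpleGraph V} (hG : G.StronglyChordal)
    (S : Set V) : (G.induce S).StronglyChordal := by
  have hc : ∀ (n : ℕ) (f : ZMod n → S), (G.induce S).IsCycleEmb f →
      G.IsCycleEmb (fun i => (f i : V)) := fun n f hf =>
    ⟨Subtype.val_injective.comp hf.1, fun i => hf.2 i⟩
  constructor
  · intro n hn f hf
    obtain ⟨i, j, h⟩ := hG.1 n hn _ (hc n f hf)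
    exact ⟨i, j, h⟩
  · intro n hn he f hf
    obtain ⟨i, j, h⟩ := hG.2 n hn he _ (hc n f hf)
    exact ⟨i, j, h⟩

/-- simple vertex in the subgraph induced by a cycle -/
lemma cycle_simple {V : Type*} {G : SimpleGraph V}
    (hS : ∀ S : Set V, S.Nonempty → ∃ v : S, (G.induce S).IsSimpleVertex v)
    {n : ℕ} (f : ZMod n → V) (hf : G.IsCycleEmb f) :
    ∃ i : ZMod n, ∃ j : ZMod n, (j = i + 1 ∧ (∀ t, W G (f (i - 1)) (f t) → W G (f j) (f t))) ∨
      (j = i - 1 ∧ (∀ t, W G (f (i + 1)) (f t) → W G (f j) (f t))) := by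
  obtain ⟨⟨v, i, rfl⟩, hv⟩ := hS (Set.range f) ⟨f 0, 0, rfl⟩
  have hW : ∀ a b : ZMod n, (⟨f b, b, rfl⟩ : Set.range f) ∈
      (G.induce (Set.range f)).closedNbhd ⟨f a, a, rfl⟩ ↔ W G (f a) (f b) := by
    intro a b
    rw [mem_closedNbhd]
    unfold W
    rw [Subtype.ext_iff]
    exact Iff.rfl
  have hm : W G (f i) (f (i - 1)) := by
    have := hf.2 (i - 1)
    rw [sub_add_cancel] at this
    exact Or.inr this.symm
  rcases hv ⟨f (i - 1), _, rfl⟩ ⟨f (i + 1), _, rfl⟩ ((hW i (i - 1)).2 hm)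
    ((hW i (i + 1)).2 (Or.inr (hf.2 i))) with h | h
  · exact ⟨i, _, Or.inl ⟨rfl, fun t ht => (hW _ _).1 (h ((hW _ _).2 ht))⟩⟩
  · exact ⟨i, _, Or.inr ⟨rfl, fun t ht => (hW _ _).1 (h ((hW _ _).2 ht))⟩⟩

lemma small_ne {n : ℕ} (m : ℕ) (h0 : 0 < m) (hm : m < n) : (m : ZMod n) ≠ 0 := by
  intro h
  rw [ZMod.natCast_eq_zero_iff] at h
  exact absurd (Nat.le_of_dvd h0 h) (by omega)

lemma backward {V : Type*} {G : SimpleGraph V}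
    (hS : ∀ S : Set V, S.Nonempty → ∃ v : S, (G.induce S).IsSimpleVertex v) :
    G.StronglyChordal := by
  constructor
  · intro n hn f hf
    have c1 := small_ne (n := n) 1 (by omega) (by omega)
    have c2 := small_ne (n := n) 2 (by omega) (by omega)
    have c3 := small_ne (n := n) 3 (by omega) (by omega)
    push_cast at c1 c2 c3
    have hW : ∃ i, W G (f (i - 1)) (f (i + 1)) := by
      obtain ⟨i, j, ⟨rfl, h⟩ | ⟨rfl, h⟩⟩ := cycle_simple hS f hf
      · exact ⟨i, (h _ (Or.inl rfl)).symm⟩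
      · exact ⟨i, h _ (Or.inl rfl)⟩
    obtain ⟨i, h | h⟩ := hW
    · exact absurd (by linear_combination -(hf.1 h)) c2
    · refine ⟨i - 1, i + 1, h, fun e => c1 (by linear_combination e),
        fun e => c3 (by linear_combination -e)⟩
  · intro n hn he f hf
    have c1 := small_ne (n := n) 1 (by omega) (by omega)
    have c2 := small_ne (n := n) 2 (by omega) (by omega)
    have c3 := small_ne (n := n) 3 (by omega) (by omega)
    have c4 := small_ne (n := n) 4 (by omega) (by omega)
    push_cast at c1 c2 c3 c4
    have hW : ∃ i, W G (f i) (f (i + 3)) := by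
      obtain ⟨i, j, ⟨rfl, h⟩ | ⟨rfl, h⟩⟩ := cycle_simple hS f hf
      · refine ⟨i - 2, ?_⟩
        have := hf.2 (i - 2)
        rw [show i - 2 + 1 = i - 1 by ring] at this
        rw [show i - 2 + 3 = i + 1 by ring]
        exact (h _ (Or.inr this.symm)).symm
      · refine ⟨i - 1, ?_⟩
        have := hf.2 (i + 1)
        rw [show i + 1 + 1 = i - 1 + 3 by ring] at this
        exact h _ (Or.inr this)
    obtain ⟨i, h | h⟩ := hW
    · exact absurd (by linear_combination -(hf.1 h)) c3
    · refine ⟨i, i + 3, ⟨h, fun e => c2 (by linear_combination e),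
        fun e => c4 (by linear_combination -e)⟩, ?_⟩
      rw [add_sub_cancel_left]
      have h3 : (3 : ZMod n).val = 3 := by
        have := ZMod.val_natCast_of_lt (n := n) (a := 3) (by omega)
        simpa using this
      rw [h3]; decide

end SCProof

/-- A finite simple graph is strongly chordal iff every nonempty induced subgraph
has a simple vertex. -/
theorem stronglyChordal_iff_induced_simple {V : Type*} [Fintype V] (G : SimpleGraph V) :
    G.StronglyChordal ↔ ∀ S : Set V, S.Nonempty → ∃ v : S, (G.induce S).IsSimpleVertex v := by
  classical
  constructor
  · intro hG S hS
    have : Nonempty S := hS.to_subtype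
    exact SCProof.exists_simple _ (SCProof.stronglyChordal_induce hG S)
  · exact SCProof.backward
end

section
/- A finite simple graph G on vertices v_1, …, v_n is strongly chordal if and only if its neighborhood matrix M(G) is totally balanced. -/
open scoped Classical

/-- A 0-1 matrix is totally balanced if it has no `k × k` submatrix (`k ≥ 3`),
with no two identical columns, in which every row sum and every column sum
equals 2 (the edge-vertex incidence matrix of a cycle of length at least 3). -/
def TotallyBalanced {α β : Type*} [Fintype α] [Fintype β] (M : Matrix α β ℕ) : Prop :=
  ¬ ∃ (k : ℕ), 3 ≤ k ∧ ∃ (r : Fin k → α) (c : Fin k → β),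
      Function.Injective r ∧ Function.Injective c ∧
      (∀ j j' : Fin k, (∀ i : Fin k, M (r i) (c j) = M (r i) (c j')) → j = j') ∧
      (∀ i : Fin k, ∑ j : Fin k, M (r i) (c j) = 2) ∧
      (∀ j : Fin k, ∑ i : Fin k, M (r i) (c j) = 2)

/-- The neighborhood matrix `M(G)` of `G` with respect to the vertex ordering `σ`:
the `(i, j)` entry is 1 if `σ i ∈ N[σ j]` and 0 otherwise. -/
noncomputable def SimpleGraph.nbhdMatrix {V : Type*} [Fintype V] (G : SimpleGraph V)
    (σ : Fin (Fintype.card V) ≃ V) :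
    Matrix (Fin (Fintype.card V)) (Fin (Fintype.card V)) ℕ :=
  fun i j => if σ i ∈ G.closedNbhd (σ j) then 1 else 0


theorem exists_natCast_lt {n : ℕ} (hn : 0 < n) (i : ZMod n) : ∃ a : ℕ, a < n ∧ (a : ZMod n) = i := by
  have : NeZero n := ⟨hn.ne'⟩
  exact ⟨i.val, ZMod.val_lt i, ZMod.natCast_zmod_val i⟩

theorem natCast_eq_iff_of_lt {n a b : ℕ} (ha : a < n) (hb : b < n) :
    ((a : ZMod n) = (b : ZMod n)) ↔ a = b := by
  rw [ZMod.natCast_eq_natCast_iff', Nat.mod_eq_of_lt ha, Nat.mod_eq_of_lt hb]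

theorem natCast_eq_succ_iff {n a b : ℕ} (ha : a < n) (hb : b < n) :
    ((b : ZMod n) = (a : ZMod n) + 1) ↔ b = a + 1 ∨ (b = 0 ∧ a + 1 = n) := by
  have : (a : ZMod n) + 1 = ((a + 1 : ℕ) : ZMod n) := by push_cast; rfl
  rw [this, ZMod.natCast_eq_natCast_iff', Nat.mod_eq_of_lt hb]
  rcases Nat.lt_or_ge (a + 1) n with h | h
  · rw [Nat.mod_eq_of_lt h]; omega
  · have : a + 1 = n := by omega
    rw [this, Nat.mod_self]; omega

theorem odd_sub_val_iff {n a b : ℕ} (hn : Even n) (ha : a < n) (hb : b < n) :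
    Odd ((b : ZMod n) - (a : ZMod n)).val ↔ Odd (a + b) := by
  have h0 : (b : ZMod n) - (a : ZMod n) = ((b + n - a : ℕ) : ZMod n) := by
    rw [Nat.cast_sub (by omega)]; push_cast; simp
  rw [h0, ZMod.val_natCast]
  rcases Nat.lt_or_ge (b + n - a) n with h | h
  · rw [Nat.mod_eq_of_lt h]; simp only [Nat.odd_iff, Nat.even_iff] at *; omega
  · rw [Nat.mod_eq_sub_mod h, Nat.mod_eq_of_lt (by omega)]
    simp only [Nat.odd_iff, Nat.even_iff] at *; omega

theorem mem_cn {V : Type*} (G : SimpleGraph V) (u v : V) :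
    u ∈ G.closedNbhd v ↔ u = v ∨ G.Adj u v := by
  simp [SimpleGraph.closedNbhd, G.adj_comm]

theorem mem_cn_comm {V : Type*} (G : SimpleGraph V) (u v : V) :
    u ∈ G.closedNbhd v ↔ v ∈ G.closedNbhd u := by
  rw [mem_cn, mem_cn, G.adj_comm, eq_comm]

/-- In a chordal graph, two neighbours of `v` joined by a path avoiding the rest of `N[v]`
are adjacent. -/
theorem chordal_nbrs {V : Type*} (G : SimpleGraph V) (hG : G.Chordal) (v : V) (T : Set V)
    (a b : T) (hva : G.Adj v a) (hvb : G.Adj v b) (hvT : v ∉ T)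
    (hT : ∀ t ∈ T, G.Adj v t → t = a ∨ t = b) (hr : (G.induce T).Reachable a b) :
    (a : V) = b ∨ G.Adj a b := by
  obtain ⟨p, hp⟩ := hr.exists_walk_length_eq_dist
  have hpath := p.isPath_of_length_eq_dist hp
  set d := p.length with hd
  have hinj : ∀ i j, i ≤ d → j ≤ d → p.getVert i = p.getVert j → i = j := fun i j hi hj h =>
    hpath.getVert_injOn hi hj h
  have hch : ∀ i j, j ≤ d → i + 1 < j → ¬ G.Adj (p.getVert i) (p.getVert j) := by
    intro i j hj hij h
    have h' : (G.induce T).Adj (p.getVert i) (p.getVert j) := h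
    have := SimpleGraph.dist_le ((p.take i).append (SimpleGraph.Walk.cons h' (p.drop j)))
    simp at this
    omega
  rcases Nat.lt_or_ge d 2 with h2 | h2
  · rcases Nat.lt_or_ge d 1 with h1 | h1
    · left
      have := p.eq_of_length_eq_zero (by omega)
      rw [this]
    · right
      have := p.adj_of_length_eq_one (by omega)
      exact this
  exfalso
  have ha0 : p.getVert 0 = a := p.getVert_zero
  have hbd : p.getVert d = b := p.getVert_length
  let g : ℕ → V := fun m => if m ≤ d then (p.getVert m : V) else v
  have hg1 : ∀ m, m ≤ d → g m = p.getVert m := fun m hm => if_pos hm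
  have hg2 : g (d + 1) = v := if_neg (by omega)
  have hmem : ∀ m, m ≤ d → g m ∈ T := fun m hm => by rw [hg1 m hm]; exact (p.getVert m).2
  have hginj : ∀ i j, i < d + 2 → j < d + 2 → g i = g j → i = j := by
    intro i j hi hj h
    rcases Nat.lt_or_ge d i with hi' | hi' <;> rcases Nat.lt_or_ge d j with hj' | hj'
    · omega
    · obtain rfl : i = d + 1 := by omega
      exact absurd (hmem j hj') (by rw [← h, hg2]; exact hvT)
    · obtain rfl : j = d + 1 := by omega
      exact absurd (hmem i hi') (by rw [h, hg2]; exact hvT)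
    · rw [hg1 i hi', hg1 j hj'] at h
      exact hinj i j hi' hj' (Subtype.ext h)
  have hvg : ∀ m, m ≤ d → G.Adj v (g m) → m = 0 ∨ m = d := by
    intro m hm h
    rcases hT _ (hmem m hm) h with h | h
    · left; apply hinj m 0 hm (by omega)
      rw [ha0]; apply Subtype.ext; rw [← h, hg1 m hm]
    · right; apply hinj m d hm (by omega)
      rw [hbd]; apply Subtype.ext; rw [← h, hg1 m hm]
  have hgch : ∀ i j, i + 1 < j → j < d + 2 → G.Adj (g i) (g j) → i = 0 ∧ j = d + 1 := by
    intro i j hij hj h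
    rcases Nat.lt_or_ge d j with hj' | hj'
    · obtain rfl : j = d + 1 := by omega
      rw [hg2] at h
      rcases hvg i (by omega) h.symm with h | h <;> omega
    · rw [hg1 i (by omega), hg1 j hj'] at h
      exact absurd h (hch i j hj' hij)
  have : NeZero (d + 2) := ⟨by omega⟩
  have hval : ∀ m : ℕ, m < d + 2 → ((m : ZMod (d + 2))).val = m := fun m hm => by
    rw [ZMod.val_natCast, Nat.mod_eq_of_lt hm]
  obtain ⟨i, j, hadj, h1, h2⟩ := hG (d + 2) (by omega) (fun i => g i.val) (by
    constructor
    · intro i j h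
      exact ZMod.val_injective _ (hginj _ _ (ZMod.val_lt i) (ZMod.val_lt j) h)
    · intro i
      obtain ⟨m, hm, rfl⟩ := exists_natCast_lt (by omega) i
      have hs : ((m : ZMod (d+2)) + 1) = ((m + 1 : ℕ) : ZMod (d+2)) := by push_cast; rfl
      rcases Nat.lt_or_ge (m + 1) (d + 2) with hm1 | hm1
      · show G.Adj (g (m : ZMod (d+2)).val) (g ((m : ZMod (d+2)) + 1).val)
        rw [hs, hval _ hm, hval _ hm1]
        rcases Nat.lt_or_ge m d with h | h
        · rw [hg1 m (by omega), hg1 (m+1) (by omega)]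
          exact p.adj_getVert_succ h
        · have hmd : m = d := by omega
          rw [hmd, hg2, hg1 d le_rfl, hbd]; exact hvb.symm
      · obtain rfl : m = d + 1 := by omega
        show G.Adj (g ((d + 1 : ℕ) : ZMod (d+2)).val) (g (((d + 1 : ℕ) : ZMod (d+2)) + 1).val)
        rw [hs, hval _ hm, ZMod.natCast_self, ZMod.val_zero, hg2, hg1 0 (by omega), ha0]
        exact hva)
  obtain ⟨x, hx, rfl⟩ := exists_natCast_lt (by omega) i
  obtain ⟨y, hy, rfl⟩ := exists_natCast_lt (by omega) j
  rw [Ne, natCast_eq_succ_iff hx hy] at h1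
  rw [Ne, natCast_eq_succ_iff hy hx] at h2
  simp only [hval _ hx, hval _ hy] at hadj
  have hne : x ≠ y := by rintro rfl; exact G.loopless.irrefl _ hadj
  rcases Nat.lt_or_ge x y with h | h
  · have := hgch x y (by omega) hy hadj
    omega
  · have := hgch y x (by omega) hx hadj.symm
    omega

/-- A cyclic sequence in which closed adjacency at odd distance is exactly consecutiveness. -/
def BadSeq {V : Type*} (G : SimpleGraph V) (n : ℕ) (w : ZMod n → V) : Prop :=
  (∀ i j, Odd (j - i).val → (w i ∈ G.closedNbhd (w j) ↔ j = i + 1 ∨ i = j + 1)) ∧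
  (∀ i j, i ≠ j → ¬ Odd (j - i).val → w i ≠ w j)

theorem BadSeq.shift {V : Type*} {G : SimpleGraph V} {n : ℕ} {w : ZMod n → V}
    (h : BadSeq G n w) (a : ZMod n) : BadSeq G n (fun i => w (i + a)) := by
  constructor
  · intro i j hij
    rw [h.1 (i + a) (j + a) (by simpa using hij)]
    rw [add_right_comm, add_right_comm j, add_left_inj, add_left_inj]
  · intro i j hij hodd
    exact h.2 _ _ (by simpa using hij) (by simpa using hodd)

theorem BadSeq.collapse {V : Type*} {G : SimpleGraph V} {n : ℕ} {w : ZMod n → V}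
    (h : BadSeq G n w) (hn : 6 ≤ n) (hne : Even n) (hG : G.Chordal) (h01 : w 0 = w 1) : False := by
  let g : ℕ → V := fun m => w (m : ZMod n)
  have hg : ∀ a b, a < n → b < n → Odd (a + b) → (g a ∈ G.closedNbhd (g b) ↔
      b = a + 1 ∨ a = b + 1 ∨ (a = 0 ∧ b + 1 = n) ∨ (b = 0 ∧ a + 1 = n)) := by
    intro a b ha hb hab
    rw [h.1 _ _ ((odd_sub_val_iff hne ha hb).2 hab), natCast_eq_succ_iff ha hb,
      natCast_eq_succ_iff hb ha]
    omega
  have hg2 : ∀ a b, a < n → b < n → a ≠ b → ¬ Odd (a + b) → g a ≠ g b := by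
    intro a b ha hb hab hodd
    exact h.2 _ _ (by rwa [Ne, natCast_eq_iff_of_lt ha hb]) (by rwa [odd_sub_val_iff hne ha hb])
  have g01 : g 0 = g 1 := by simpa [g] using h01
  have hev : n % 2 = 0 := Nat.even_iff.1 hne
  let T : Set V := {x | ∃ m, 2 ≤ m ∧ m < n ∧ g m = x}
  have key : ∀ m, 2 ≤ m → m < n → g m ∈ G.closedNbhd (g 0) → m = 2 ∨ m + 1 = n := by
    intro m h2 hm hmem
    rcases Nat.even_or_odd m with he | ho
    · rw [g01, hg m 1 hm (by omega) (by simpa using he.add_one)] at hmem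
      omega
    · rw [hg m 0 hm (by omega) (by simpa using ho)] at hmem
      omega
  have hm2 : g 2 ∈ G.closedNbhd (g 0) := by
    rw [g01, hg 2 1 (by omega) (by omega) (by decide)]; omega
  have hml : g (n-1) ∈ G.closedNbhd (g 0) := by
    rw [hg (n-1) 0 (by omega) (by omega) (by rw [Nat.odd_iff]; omega)]; omega
  have hne2 : g 2 ≠ g 0 := hg2 2 0 (by omega) (by omega) (by omega) (by decide)
  have hnel : g (n-1) ≠ g 0 := by
    rw [g01]
    exact hg2 (n-1) 1 (by omega) (by omega) (by omega) (by rw [Nat.odd_iff]; omega)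
  have hadj2 : G.Adj (g 0) (g 2) := (((mem_cn G _ _).1 hm2).resolve_left hne2).symm
  have hadjl : G.Adj (g 0) (g (n-1)) := (((mem_cn G _ _).1 hml).resolve_left hnel).symm
  have hT : ∀ m, 2 ≤ m → m < n → g m ∈ T := fun m h1 h2 => ⟨m, h1, h2, rfl⟩
  have hreach : ∀ m (h2 : 2 ≤ m) (hm : m < n),
      (G.induce T).Reachable ⟨g 2, hT 2 le_rfl (by omega)⟩ ⟨g m, hT m h2 hm⟩ := by
    intro m h2
    induction m, h2 using Nat.le_induction with
    | base => intro hm; exact SimpleGraph.Reachable.refl _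
    | succ m h2 ih =>
      intro hm
      refine (ih (by omega)).trans ?_
      have : g m ∈ G.closedNbhd (g (m+1)) := by
        rw [hg m (m+1) (by omega) hm (by rw [Nat.odd_iff]; omega)]; omega
      rcases (mem_cn G _ _).1 this with h | h
      · have : (⟨g m, hT m h2 (by omega)⟩ : T) = ⟨g (m+1), hT (m+1) (by omega) hm⟩ :=
          Subtype.ext h
        rw [this]
      · exact SimpleGraph.Adj.reachable (G := G.induce T) h
  have := chordal_nbrs G hG (g 0) T ⟨g 2, hT 2 le_rfl (by omega)⟩
    ⟨g (n-1), hT (n-1) (by omega) (by omega)⟩ hadj2 hadjl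
    (by
      rintro ⟨m, h2, hm, hmg⟩
      rcases key m h2 hm (by rw [hmg, mem_cn]; exact Or.inl rfl) with h | h
      · subst h; exact hne2 hmg
      · obtain rfl : m = n - 1 := by omega
        exact hnel hmg)
    (by
      rintro t ⟨m, h2, hm, rfl⟩ hadj
      rcases key m h2 hm (by rw [mem_cn]; exact Or.inr hadj.symm) with h | h
      · subst h; exact Or.inl rfl
      · obtain rfl : m = n - 1 := by omega
        exact Or.inr rfl)
    (hreach (n-1) (by omega) (by omega))
  have h3 := (mem_cn G _ _).2 this
  rw [hg 2 (n-1) (by omega) (by omega) (by rw [Nat.odd_iff]; omega)] at h3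
  omega

theorem BadSeq.false {V : Type*} {G : SimpleGraph V} {n : ℕ} {w : ZMod n → V}
    (h : BadSeq G n w) (hn : 6 ≤ n) (hne : Even n) (hG : G.StronglyChordal) : False := by
  have hcol : ∀ i, w i ≠ w (i + 1) := by
    intro i hi
    refine (h.shift i).collapse hn hne hG.1 ?_
    simpa [add_comm] using hi
  have : Fact (1 < n) := ⟨by omega⟩
  have hinj : Function.Injective w := by
    intro i j hij
    by_contra hne'
    by_cases ho : Odd (j - i).val
    · rcases (h.1 i j ho).1 (by rw [mem_cn]; exact Or.inl hij) with rfl | rfl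
      · exact hcol _ hij
      · exact hcol _ hij.symm
    · exact h.2 i j hne' ho hij
  obtain ⟨i, j, ⟨hadj, h1, h2⟩, ho⟩ := hG.2 n hn hne w ⟨hinj, fun i => by
    have := (h.1 i (i+1) (by simp [ZMod.val_one])).2 (Or.inl rfl)
    exact ((mem_cn G _ _).1 this).resolve_left (hcol i)⟩
  rcases (h.1 i j ho).1 (by rw [mem_cn]; exact Or.inr hadj) with h | h
  · exact h1 h
  · exact h2 h

theorem sum_ite_eq_two {k : ℕ} (P : Fin k → Prop) [DecidablePred P] (a b : Fin k) (hab : a ≠ b)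
    (h : ∀ j, P j ↔ j = a ∨ j = b) : ∑ j : Fin k, (if P j then 1 else 0 : ℕ) = 2 := by
  rw [Finset.sum_boole]
  have : Finset.univ.filter P = {a, b} := by ext j; simp [h]
  rw [this, Finset.card_pair hab]; rfl

theorem not_tb {V : Type*} [Fintype V] (G : SimpleGraph V) (σ : Fin (Fintype.card V) ≃ V)
    (k : ℕ) (hk : 3 ≤ k) (x y : ℕ → V)
    (hx : ∀ i j, i < k → j < k → x i = x j → i = j)
    (hy : ∀ i j, i < k → j < k → y i = y j → i = j)
    (hxy : ∀ i j, i < k → j < k →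
      (x i ∈ G.closedNbhd (y j) ↔ i = j ∨ i = j + 1 ∨ (i = 0 ∧ j + 1 = k))) :
    ¬ TotallyBalanced (G.nbhdMatrix σ) := by
  intro hTB
  have hM : ∀ i j : Fin k, G.nbhdMatrix σ (σ.symm (x i)) (σ.symm (y j)) =
      if ((i : ℕ) = j ∨ (i : ℕ) = j + 1 ∨ ((i : ℕ) = 0 ∧ (j : ℕ) + 1 = k)) then 1 else 0 := by
    intro i j
    simp only [SimpleGraph.nbhdMatrix, Equiv.apply_symm_apply]
    exact if_congr (hxy i j i.2 j.2) rfl rfl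
  refine hTB ⟨k, hk, fun i => σ.symm (x i), fun j => σ.symm (y j), ?_, ?_, ?_, ?_, ?_⟩
  · intro i j h
    exact Fin.ext (hx _ _ i.2 j.2 (σ.symm.injective h))
  · intro i j h
    exact Fin.ext (hy _ _ i.2 j.2 (σ.symm.injective h))
  · intro j j' h
    have h1 := h j
    have h2 := h j'
    rw [hM, hM] at h1 h2
    have a1 := j.2
    have a2 := j'.2
    ext
    split_ifs at h1 h2 <;> omega
  · intro i
    simp only [hM]
    have hi := i.2
    refine sum_ite_eq_two _ i ⟨if (i : ℕ) = 0 then k - 1 else i - 1, by split_ifs <;> omega⟩ ?_ ?_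
    · rw [Ne, Fin.ext_iff]; simp only; split_ifs <;> omega
    · intro j
      have hj := j.2
      simp only [Fin.ext_iff]; split_ifs <;> omega
  · intro j
    simp only [hM]
    have hj := j.2
    refine sum_ite_eq_two _ j ⟨if (j : ℕ) + 1 = k then 0 else j + 1, by split_ifs <;> omega⟩ ?_ ?_
    · rw [Ne, Fin.ext_iff]; simp only; split_ifs <;> omega
    · intro i
      have hi := i.2
      simp only [Fin.ext_iff]; split_ifs <;> omega

theorem sc_of_tb {V : Type*} [Fintype V] (G : SimpleGraph V) (σ : Fin (Fintype.card V) ≃ V)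
    (hTB : TotallyBalanced (G.nbhdMatrix σ)) : G.StronglyChordal := by
  have hst : ∀ (n : ℕ), 6 ≤ n → Even n → ∀ f : ZMod n → V, G.IsCycleEmb f →
      ∃ i j, G.IsStrongChordOf f i j := by
    intro n hn hne f hf
    by_contra hno
    have hev : n % 2 = 0 := Nat.even_iff.1 hne
    have inj : ∀ a b : ℕ, a < n → b < n → f a = f b → a = b := fun a b ha hb h =>
      (natCast_eq_iff_of_lt ha hb).1 (hf.1 h)
    have hg : ∀ a b : ℕ, a < n → b < n → Odd (a + b) → (f a ∈ G.closedNbhd (f b) ↔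
        b = a + 1 ∨ a = b + 1 ∨ (a = 0 ∧ b + 1 = n) ∨ (b = 0 ∧ a + 1 = n)) := by
      intro a b ha hb hab
      have : (b = a + 1 ∨ a = b + 1 ∨ (a = 0 ∧ b + 1 = n) ∨ (b = 0 ∧ a + 1 = n)) ↔
          ((b : ZMod n) = a + 1 ∨ (a : ZMod n) = b + 1) := by
        rw [natCast_eq_succ_iff ha hb, natCast_eq_succ_iff hb ha]; omega
      rw [this, mem_cn]
      constructor
      · rintro (h | h)
        · have := inj a b ha hb h
          rw [Nat.odd_iff] at hab; omega
        · by_contra hc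
          push Not at hc
          exact hno ⟨a, b, ⟨h, hc.1, hc.2⟩, (odd_sub_val_iff hne ha hb).2 hab⟩
      · rintro (h | h)
        · right; rw [h]; exact hf.2 _
        · right; rw [h]; exact (hf.2 _).symm
    refine not_tb G σ (n / 2) (by omega) (fun i => f ((2 * i : ℕ) : ZMod n))
      (fun i => f ((2 * i + 1 : ℕ) : ZMod n)) ?_ ?_ ?_ hTB
    · intro i j hi hj h
      have := inj _ _ (by omega) (by omega) h
      omega
    · intro i j hi hj h
      have := inj _ _ (by omega) (by omega) h
      omega
    · intro i j hi hj
      rw [hg _ _ (by omega) (by omega) (by rw [Nat.odd_iff]; omega)]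
      omega
  refine ⟨?_, hst⟩
  intro n hn f hf
  by_cases h6 : 6 ≤ n ∧ Even n
  · obtain ⟨i, j, h, -⟩ := hst n h6.1 h6.2 f hf
    exact ⟨i, j, h⟩
  by_contra hno
  have inj : ∀ a b : ℕ, a < n → b < n → f a = f b → a = b := fun a b ha hb h =>
    (natCast_eq_iff_of_lt ha hb).1 (hf.1 h)
  have hg : ∀ a b : ℕ, a < n → b < n → (f a ∈ G.closedNbhd (f b) ↔
      a = b ∨ b = a + 1 ∨ a = b + 1 ∨ (a = 0 ∧ b + 1 = n) ∨ (b = 0 ∧ a + 1 = n)) := by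
    intro a b ha hb
    have : (a = b ∨ b = a + 1 ∨ a = b + 1 ∨ (a = 0 ∧ b + 1 = n) ∨ (b = 0 ∧ a + 1 = n)) ↔
        (a = b ∨ (b : ZMod n) = a + 1 ∨ (a : ZMod n) = b + 1) := by
      rw [natCast_eq_succ_iff ha hb, natCast_eq_succ_iff hb ha]; omega
    rw [this, mem_cn]
    constructor
    · rintro (h | h)
      · exact Or.inl (inj a b ha hb h)
      · by_contra hc
        push Not at hc
        exact hno ⟨a, b, h, hc.2.1, hc.2.2⟩
    · rintro (h | h | h)
      · left; rw [h]
      · right; rw [h]; exact hf.2 _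
      · right; rw [h]; exact (hf.2 _).symm
  by_cases h4 : n = 4
  · refine not_tb G σ 3 le_rfl (fun i => f ((i : ℕ) : ZMod n))
      (fun i => f (((if i = 0 then 0 else i + 1) : ℕ) : ZMod n)) ?_ ?_ ?_ hTB
    · intro i j hi hj h
      exact inj _ _ (by omega) (by omega) h
    · intro i j hi hj h
      have := inj _ _ (by split_ifs <;> omega) (by split_ifs <;> omega) h
      split_ifs at this <;> omega
    · intro i j hi hj
      by_cases h0 : j = 0
      · simp only [if_pos h0]
        rw [hg _ _ (by omega) (by omega)]
        omega
      · simp only [if_neg h0]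
        rw [hg _ _ (by omega) (by omega)]
        omega
  · have hod : n % 2 = 1 ∧ 5 ≤ n := by
      rw [Nat.even_iff] at h6
      omega
    refine not_tb G σ ((n + 1) / 2) (by omega) (fun i => f ((2 * i : ℕ) : ZMod n))
      (fun i => f (((if 2 * i + 1 = n then 0 else 2 * i + 1) : ℕ) : ZMod n)) ?_ ?_ ?_ hTB
    · intro i j hi hj h
      have := inj _ _ (by omega) (by omega) h
      omega
    · intro i j hi hj h
      have := inj _ _ (by split_ifs <;> omega) (by split_ifs <;> omega) h
      split_ifs at this <;> omega
    · intro i j hi hj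
      by_cases h0 : 2 * j + 1 = n
      · simp only [if_pos h0]
        rw [hg _ _ (by omega) (by omega)]
        omega
      · simp only [if_neg h0]
        rw [hg _ _ (by omega) (by omega)]
        omega

theorem tb_of_sc {V : Type*} [Fintype V] (G : SimpleGraph V) (σ : Fin (Fintype.card V) ≃ V)
    (hG : G.StronglyChordal) : TotallyBalanced (G.nbhdMatrix σ) := by
  rintro ⟨k, hk, r, c, hr, hc, hcol, hrs, hcs⟩
  let R : Fin k → Fin k → Prop := fun i j => σ (r i) ∈ G.closedNbhd (σ (c j))
  let H : SimpleGraph (Fin k ⊕ Fin k) :=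
    { Adj := fun u v => match u, v with
        | Sum.inl i, Sum.inr j => R i j
        | Sum.inr j, Sum.inl i => R i j
        | _, _ => False
      symm := ⟨by rintro (i | i) (j | j) h <;> exact h⟩
      loopless := ⟨by rintro (i | i) h <;> exact h⟩ }
  have hlr : ∀ i j, H.Adj (Sum.inl i) (Sum.inr j) ↔ R i j := fun i j => Iff.rfl
  have hrl : ∀ i j, H.Adj (Sum.inr j) (Sum.inl i) ↔ R i j := fun i j => Iff.rfl
  have hside : ∀ u v, H.Adj u v → u.isLeft = !v.isLeft := by
    rintro (i | i) (j | j) h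
    · exact h.elim
    · rfl
    · rfl
    · exact h.elim
  let φ : Fin k ⊕ Fin k → V := Sum.elim (fun i => σ (r i)) (fun j => σ (c j))
  have hφ : ∀ u v, u.isLeft = (!v.isLeft) → (φ u ∈ G.closedNbhd (φ v) ↔ H.Adj u v) := by
    rintro (i | i) (j | j) h
    · simp at h
    · rfl
    · rw [mem_cn_comm]; rfl
    · simp at h
  have hφinj : ∀ u v, u.isLeft = v.isLeft → φ u = φ v → u = v := by
    rintro (i | i) (j | j) h h'
    · rw [hr (σ.injective h')]
    · simp at h
    · simp at h
    · rw [hc (σ.injective h')]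
  have hdeg : ∀ v, (H.neighborSet v).ncard = 2 := by
    rintro (i | j)
    · have : H.neighborSet (Sum.inl i) = Sum.inr '' {j | R i j} := by
        ext (u | u)
        · simp [H]
        · simp [H]
      rw [this, Set.ncard_image_of_injective _ Sum.inr_injective, Set.ncard_eq_toFinset_card',
        Set.toFinset_ofPred, ← hrs i]
      simp only [SimpleGraph.nbhdMatrix]
      rw [Finset.sum_boole]; rfl
    · have : H.neighborSet (Sum.inr j) = Sum.inl '' {i | R i j} := by
        ext (u | u)
        · simp [H]
        · simp [H]
      rw [this, Set.ncard_image_of_injective _ Sum.inl_injective, Set.ncard_eq_toFinset_card',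
        Set.toFinset_ofPred, ← hcs j]
      simp only [SimpleGraph.nbhdMatrix]
      rw [Finset.sum_boole]; rfl
  have hcyc : H.IsCycles := fun v _ => hdeg v
  let v0 : Fin k ⊕ Fin k := Sum.inl ⟨0, by omega⟩
  obtain ⟨p, hp, -⟩ := hcyc.exists_cycle_toSubgraph_verts_eq_connectedComponentSupp
    (c := H.connectedComponentMk v0) (v := v0) rfl
    (Set.nonempty_of_ncard_ne_zero (by rw [hdeg]; norm_num))
  set n := p.length with hn
  have hn3 : 3 ≤ n := hp.three_le_length
  have hz : p.getVert 0 = v0 := p.getVert_zero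
  have hl : p.getVert n = v0 := p.getVert_length
  have hlz : p.getVert n = p.getVert 0 := hl.trans hz.symm
  have hinj : ∀ a b, a < n → b < n → p.getVert a = p.getVert b → a = b := fun a b ha hb h =>
    hp.getVert_injOn' (by show a ≤ n - 1; omega) (by show b ≤ n - 1; omega) h
  have hstep : ∀ a, a < n → H.Adj (p.getVert a) (p.getVert (a + 1)) := fun a ha =>
    p.adj_getVert_succ ha
  have hpar : ∀ a, a ≤ n → ((p.getVert a).isLeft = true ↔ a % 2 = 0) := by
    intro a
    induction a with
    | zero => intro _; simp [v0]
    | succ a ih =>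
      intro ha
      have h1 := ih (by omega)
      have h2 := hside _ _ (hstep a (by omega))
      rw [h2] at h1
      cases h : (p.getVert (a + 1)).isLeft <;> simp [h] at h1 ⊢ <;> omega
  have hev : n % 2 = 0 := by
    rw [← hpar n le_rfl, hl]; rfl
  have hadj : ∀ a b, a < n → b < n → (H.Adj (p.getVert a) (p.getVert b) ↔
      b = a + 1 ∨ a = b + 1 ∨ (a = 0 ∧ b + 1 = n) ∨ (b = 0 ∧ a + 1 = n)) := by
    intro a b ha hb
    let s := if a + 1 = n then 0 else a + 1
    let t := if a = 0 then n - 1 else a - 1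
    have hs : s < n := by simp only [s]; split_ifs <;> omega
    have ht : t < n := by simp only [t]; split_ifs <;> omega
    have hst : s ≠ t := by simp only [s, t]; split_ifs <;> omega
    have has : H.Adj (p.getVert a) (p.getVert s) := by
      have := hstep a ha
      simp only [s]
      split_ifs with h
      · rw [h, hlz] at this; exact this
      · exact this
    have hat : H.Adj (p.getVert a) (p.getVert t) := by
      simp only [t]
      split_ifs with h
      · have := hstep (n - 1) (by omega)
        rw [Nat.sub_add_cancel (by omega), hlz] at this
        rw [h]; exact this.symm
      · have := hstep (a - 1) (by omega)
        rw [Nat.sub_add_cancel (by omega)] at this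
        exact this.symm
    have hset : ({p.getVert s, p.getVert t} : Set _) = H.neighborSet (p.getVert a) := by
      apply Set.eq_of_subset_of_ncard_le
      · rintro u (rfl | rfl)
        · exact has
        · exact hat
      · rw [hdeg, Set.ncard_pair (fun h => hst (hinj _ _ hs ht h))]
      · exact Set.toFinite _
    have : H.Adj (p.getVert a) (p.getVert b) ↔ b = s ∨ b = t := by
      rw [← SimpleGraph.mem_neighborSet, ← hset]
      constructor
      · rintro (h | h)
        · exact Or.inl (hinj _ _ hb hs h)
        · exact Or.inr (hinj _ _ hb ht h)
      · rintro (h | h)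
        · rw [h]; exact Or.inl rfl
        · rw [h]; exact Or.inr rfl
    rw [this]
    simp only [s, t]
    split_ifs <;> omega
  have hn4 : n ≠ 4 := by
    intro h4
    have hsub : ∀ a b, a < 4 → b < 4 → b = a + 2 ∨ a = b + 2 →
        H.neighborSet (p.getVert a) ⊆ H.neighborSet (p.getVert b) := by
      intro a b ha hb hab u hu
      have hset : ({p.getVert (if a + 1 = n then 0 else a + 1),
          p.getVert (if a = 0 then n - 1 else a - 1)} : Set _) = H.neighborSet (p.getVert a) := by
        apply Set.eq_of_subset_of_ncard_le
        · rintro u (rfl | rfl)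
          · rw [SimpleGraph.mem_neighborSet, hadj _ _ (by omega) (by split_ifs <;> omega)]
            split_ifs <;> omega
          · rw [SimpleGraph.mem_neighborSet, hadj _ _ (by omega) (by split_ifs <;> omega)]
            split_ifs <;> omega
        · rw [hdeg, Set.ncard_pair (fun h => ?_)]
          have := hinj _ _ (by split_ifs <;> omega) (by split_ifs <;> omega) h
          split_ifs at this <;> omega
        · exact Set.toFinite _
      rw [← hset] at hu
      rcases hu with rfl | rfl
      · rw [SimpleGraph.mem_neighborSet, hadj _ _ (by omega) (by split_ifs <;> omega)]
        split_ifs <;> omega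
      · rw [SimpleGraph.mem_neighborSet, hadj _ _ (by omega) (by split_ifs <;> omega)]
        split_ifs <;> omega
    have heq : H.neighborSet (p.getVert 1) = H.neighborSet (p.getVert 3) :=
      Set.Subset.antisymm (hsub 1 3 (by omega) (by omega) (by omega))
        (hsub 3 1 (by omega) (by omega) (by omega))
    have p1 := hpar 1 (by omega)
    have p3 := hpar 3 (by omega)
    have hne : p.getVert 1 ≠ p.getVert 3 := fun h => by
      have := hinj 1 3 (by omega) (by omega) h
      omega
    rcases h1 : p.getVert 1 with j | j
    · rw [h1] at p1; simp at p1
    rcases h3 : p.getVert 3 with j' | j'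
    · rw [h3] at p3; simp at p3
    rw [h1, h3] at heq hne
    apply hne
    rw [hcol j j' ?_]
    intro i
    have : R i j ↔ R i j' := by
      rw [← hrl, ← hrl, ← SimpleGraph.mem_neighborSet, heq]; rfl
    simp only [SimpleGraph.nbhdMatrix]
    exact if_congr this rfl rfl
  have hne : Even n := Nat.even_iff.2 hev
  have hval : ∀ m : ℕ, m < n → ((m : ZMod n)).val = m := fun m hm => by
    rw [ZMod.val_natCast, Nat.mod_eq_of_lt hm]
  refine BadSeq.false (G := G) (n := n) (w := fun i => φ (p.getVert i.val)) ⟨?_, ?_⟩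
    (by omega) hne hG
  · intro i j ho
    obtain ⟨a, ha, rfl⟩ := exists_natCast_lt (by omega) i
    obtain ⟨b, hb, rfl⟩ := exists_natCast_lt (by omega) j
    rw [odd_sub_val_iff hne ha hb, Nat.odd_iff] at ho
    simp only [hval _ ha, hval _ hb]
    have pa := hpar a (by omega)
    have pb := hpar b (by omega)
    rw [hφ, hadj a b ha hb, natCast_eq_succ_iff ha hb, natCast_eq_succ_iff hb ha]
    · omega
    · cases h1 : (p.getVert a).isLeft <;> cases h2 : (p.getVert b).isLeft <;>
        simp [h1, h2] at pa pb ⊢ <;> omega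
  · intro i j hij ho
    obtain ⟨a, ha, rfl⟩ := exists_natCast_lt (by omega) i
    obtain ⟨b, hb, rfl⟩ := exists_natCast_lt (by omega) j
    rw [odd_sub_val_iff hne ha hb, Nat.odd_iff] at ho
    rw [Ne, natCast_eq_iff_of_lt ha hb] at hij
    simp only [hval _ ha, hval _ hb]
    have pa := hpar a (by omega)
    have pb := hpar b (by omega)
    intro h
    refine hij (hinj a b ha hb (hφinj _ _ ?_ h))
    cases h1 : (p.getVert a).isLeft <;> cases h2 : (p.getVert b).isLeft <;>
        simp [h1, h2] at pa pb ⊢ <;> omega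

/-- Farber: a finite simple graph is strongly chordal iff its neighborhood matrix is
totally balanced. -/
theorem stronglyChordal_iff_nbhdMatrix_totallyBalanced {V : Type*} [Fintype V]
    (G : SimpleGraph V) (σ : Fin (Fintype.card V) ≃ V) :
    G.StronglyChordal ↔ TotallyBalanced (G.nbhdMatrix σ) := by
  exact ⟨tb_of_sc G σ, sc_of_tb G σ⟩
end

section
/- A finite simple graph G admits a strong elimination ordering if and only if G is chordal and every even cycle of length at least 6 in G has a strong chord. -/
section helpers

/-- closed adjacency -/
def cadj {V : Type*} (G : SimpleGraph V) (a b : V) : Prop := a = b ∨ G.Adj a b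

theorem mem_closedNbhd_iff_cadj {V : Type*} (G : SimpleGraph V) (a b : V) :
    b ∈ G.closedNbhd a ↔ cadj G a b := by
  simp [SimpleGraph.closedNbhd, cadj, eq_comm]

theorem cadj_symm {V : Type*} {G : SimpleGraph V} {a b : V} (h : cadj G a b) : cadj G b a := by
  rcases h with h | h
  · exact Or.inl h.symm
  · exact Or.inr h.symm

theorem cadj_refl {V : Type*} (G : SimpleGraph V) (a : V) : cadj G a a := Or.inl rfl

theorem zmod_natCast_ne_zero {n k : ℕ} (hk : 0 < k) (hkn : k < n) : ((k : ℕ) : ZMod n) ≠ 0 := by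
  intro h
  rw [ZMod.natCast_eq_zero_iff] at h
  exact absurd (Nat.le_of_dvd hk h) (by omega)

/-- the easy direction: common part -/
theorem seo_min {V : Type*} [Fintype V] (G : SimpleGraph V)
    (σ : Fin (Fintype.card V) ≃ V) (hσ : G.IsStrongElimOrdering σ)
    (a b c d : V) (h1 : σ.symm a < σ.symm b) (h2 : σ.symm c < σ.symm d)
    (hac : cadj G a c) (had : cadj G a d) (hbc : cadj G b c) : cadj G b d := by
  have := hσ (σ.symm a) (σ.symm b) (σ.symm c) (σ.symm d) h1 h2
  simpa [mem_closedNbhd_iff_cadj, hac, had, hbc] using this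

theorem easy_min {V : Type*} [Fintype V] (σ : Fin (Fintype.card V) ≃ V) {n : ℕ} (hn : 4 ≤ n)
    (f : ZMod n → V) (hf : Function.Injective f) :
    ∃ i, ∀ j, j ≠ i → σ.symm (f i) < σ.symm (f j) := by
  have : NeZero n := ⟨by omega⟩
  obtain ⟨i, hi⟩ := Finite.exists_min (fun i => σ.symm (f i))
  refine ⟨i, fun j hj => lt_of_le_of_ne (hi j) ?_⟩
  intro h
  exact hj (hf (σ.symm.injective h)).symm

theorem easy_dir {V : Type*} [Fintype V] (G : SimpleGraph V)
    (σ : Fin (Fintype.card V) ≃ V) (hσ : G.IsStrongElimOrdering σ) :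
    (G.Chordal ∧ ∀ (n : ℕ), 6 ≤ n → Even n → ∀ f : ZMod n → V, G.IsCycleEmb f →
        ∃ i j, G.IsStrongChordOf f i j) := by
  constructor
  · rintro n hn f ⟨hf, hadj⟩
    obtain ⟨i, hi⟩ := easy_min σ hn f hf
    have n1 := zmod_natCast_ne_zero (n := n) (k := 1) (by omega) (by omega)
    have n2 := zmod_natCast_ne_zero (n := n) (k := 2) (by omega) (by omega)
    have n3 := zmod_natCast_ne_zero (n := n) (k := 3) (by omega) (by omega)
    push_cast at n1 n2 n3
    have e1 := hadj i
    have e2 := hadj (i - 1)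
    rw [sub_add_cancel] at e2
    have ne1 : i - 1 ≠ i := fun h => n1 (by linear_combination -h)
    have ne2 : i + 1 ≠ i := fun h => n1 (by linear_combination h)
    have ne3 : i - 1 ≠ i + 1 := fun h => n2 (by linear_combination -h)
    have key := seo_min G σ hσ (f i) (f (i-1)) (f i) (f (i+1)) (hi _ ne1) (hi _ ne2)
      (cadj_refl _ _) (Or.inr e1) (Or.inr e2)
    refine ⟨i - 1, i + 1, ?_, fun h => n1 (by linear_combination h),
      fun h => n3 (by linear_combination -h)⟩
    rcases key with h | h
    · exact absurd (hf h) ne3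
    · exact h
  · rintro n hn - f ⟨hf, hadj⟩
    obtain ⟨i, hi⟩ := easy_min σ (by omega) f hf
    have n1 := zmod_natCast_ne_zero (n := n) (k := 1) (by omega) (by omega)
    have n2 := zmod_natCast_ne_zero (n := n) (k := 2) (by omega) (by omega)
    have n3 := zmod_natCast_ne_zero (n := n) (k := 3) (by omega) (by omega)
    have n4 := zmod_natCast_ne_zero (n := n) (k := 4) (by omega) (by omega)
    have v3 : Odd ((3 : ZMod n)).val := by
      have : ((3 : ℕ) : ZMod n).val = 3 := ZMod.val_cast_of_lt (by omega)
      push_cast at this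
      rw [this]; decide
    push_cast at n1 n2 n3 n4
    have e1 := hadj i
    have e2 := hadj (i - 1)
    have e3 := hadj (i + 1)
    have e4 := hadj (i - 2)
    rw [sub_add_cancel] at e2
    rw [show i + 1 + 1 = i + 2 by ring] at e3
    rw [show i - 2 + 1 = i - 1 by ring] at e4
    have ne1 : i - 2 ≠ i := fun h => n2 (by linear_combination -h)
    have ne2 : i + 2 ≠ i := fun h => n2 (by linear_combination h)
    have ne3 : i - 1 ≠ i + 1 := fun h => n2 (by linear_combination -h)
    rcases lt_trichotomy (σ.symm (f (i - 1))) (σ.symm (f (i + 1))) with h | h | h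
    · have key := seo_min G σ hσ (f i) (f (i-2)) (f (i-1)) (f (i+1)) (hi _ ne1) h
        (Or.inr e2.symm) (Or.inr e1) (Or.inr e4)
      refine ⟨i - 2, i + 1, ⟨?_, fun h => n2 (by linear_combination h),
        fun h => n4 (by linear_combination -h)⟩, ?_⟩
      · rcases key with h | h
        · exact absurd (hf h) (fun h => n3 (by linear_combination -h))
        · exact h
      · rw [show i + 1 - (i - 2) = 3 by ring]; exact v3
    · exact absurd (hf (σ.symm.injective h)) ne3
    · have key := seo_min G σ hσ (f i) (f (i+2)) (f (i+1)) (f (i-1)) (hi _ ne2) h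
        (Or.inr e1) (Or.inr e2.symm) (Or.inr e3.symm)
      refine ⟨i - 1, i + 2, ⟨?_, fun h => n2 (by linear_combination h),
        fun h => n4 (by linear_combination -h)⟩, ?_⟩
      · rcases key with h | h
        · exact absurd (hf h) (fun h => n3 (by linear_combination h))
        · exact h.symm
      · rw [show i + 2 - (i - 1) = 3 by ring]; exact v3

theorem zmod_val_add_one {n : ℕ} (hn : 2 ≤ n) (i : ZMod n) :
    i.val < n ∧ ((i.val + 1 < n ∧ (i + 1).val = i.val + 1) ∨ (i.val + 1 = n ∧ (i + 1).val = 0)) := by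
  have : NeZero n := ⟨by omega⟩
  have h := ZMod.val_lt i
  have : Fact (1 < n) := ⟨by omega⟩
  have h1 : (i + 1).val = (i.val + 1) % n := by rw [ZMod.val_add, ZMod.val_one]
  refine ⟨h, ?_⟩
  rcases Nat.lt_or_ge (i.val + 1) n with h2 | h2
  · left; rw [h1, Nat.mod_eq_of_lt h2]; exact ⟨h2, rfl⟩
  · right
    have : i.val + 1 = n := by omega
    rw [h1, this, Nat.mod_self]; exact ⟨rfl, rfl⟩

theorem isCycleEmb_nat {V : Type*} (G : SimpleGraph V) {n : ℕ} (hn : 2 ≤ n) (g : ℕ → V)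
    (hinj : ∀ a b, a < b → b < n → g a ≠ g b) (hadj : ∀ k, k + 1 < n → G.Adj (g k) (g (k + 1)))
    (hlast : G.Adj (g (n - 1)) (g 0)) :
    G.IsCycleEmb (fun i : ZMod n => g i.val) := by
  have : NeZero n := ⟨by omega⟩
  constructor
  · intro i j hij
    apply ZMod.val_injective n
    have hi := ZMod.val_lt i
    have hj := ZMod.val_lt j
    rcases lt_trichotomy i.val j.val with h | h | h
    · exact absurd hij (hinj _ _ h hj)
    · exact h
    · exact absurd hij.symm (hinj _ _ h hi)
  · intro i
    rcases zmod_val_add_one hn i with ⟨_, ⟨h, h'⟩ | ⟨h, h'⟩⟩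
    · simp only [h']; exact hadj _ h
    · simp only [h']
      rw [show i.val = n - 1 by omega]; exact hlast

theorem chord_nat {V : Type*} (G : SimpleGraph V) {n : ℕ} (hn : 2 ≤ n) (g : ℕ → V)
    (i j : ZMod n) (h : G.IsChordOf (fun i : ZMod n => g i.val) i j) :
    i.val < n ∧ j.val < n ∧ G.Adj (g i.val) (g j.val) ∧
      j.val ≠ i.val + 1 ∧ i.val ≠ j.val + 1 ∧
      ¬ (i.val = 0 ∧ j.val = n - 1) ∧ ¬ (j.val = 0 ∧ i.val = n - 1) := by
  obtain ⟨h0, h1, h2⟩ := h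
  have : NeZero n := ⟨by omega⟩
  have h1' : j.val ≠ (i+1).val := fun h => h1 (ZMod.val_injective n h)
  have h2' : i.val ≠ (j+1).val := fun h => h2 (ZMod.val_injective n h)
  have a := zmod_val_add_one hn i
  have b := zmod_val_add_one hn j
  refine ⟨a.1, b.1, h0, ?_⟩
  omega

theorem chordal_nat {V : Type*} (G : SimpleGraph V) (hG : G.Chordal) {n : ℕ} (hn : 4 ≤ n)
    (g : ℕ → V)
    (hinj : ∀ a b, a < b → b < n → g a ≠ g b) (hadj : ∀ k, k + 1 < n → G.Adj (g k) (g (k + 1)))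
    (hlast : G.Adj (g (n - 1)) (g 0)) :
    ∃ i j, i < j ∧ j < n ∧ G.Adj (g i) (g j) ∧ j ≠ i + 1 ∧ ¬ (i = 0 ∧ j = n - 1) := by
  obtain ⟨i, j, h⟩ := hG n hn _ (isCycleEmb_nat G (by omega) g hinj hadj hlast)
  obtain ⟨a, b, c, d, e, f1, f2⟩ := chord_nat G (by omega) g i j h
  rcases lt_trichotomy i.val j.val with h | h | h
  · exact ⟨_, _, h, b, c, d, f1⟩
  · rw [h] at c; exact absurd c (G.irrefl)
  · exact ⟨_, _, h, a, c.symm, e, f2⟩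

theorem strong_nat {V : Type*} (G : SimpleGraph V)
    (hG : ∀ (n : ℕ), 6 ≤ n → Even n → ∀ f : ZMod n → V, G.IsCycleEmb f →
        ∃ i j, G.IsStrongChordOf f i j) {n : ℕ} (hn : 6 ≤ n) (hev : Even n)
    (g : ℕ → V)
    (hinj : ∀ a b, a < b → b < n → g a ≠ g b) (hadj : ∀ k, k + 1 < n → G.Adj (g k) (g (k + 1)))
    (hlast : G.Adj (g (n - 1)) (g 0)) :
    ∃ i j, i < n ∧ j < n ∧ (i + j) % 2 = 1 ∧ G.Adj (g i) (g j) ∧ j ≠ i + 1 ∧ i ≠ j + 1 ∧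
      ¬ (i = 0 ∧ j = n - 1) ∧ ¬ (j = 0 ∧ i = n - 1) := by
  obtain ⟨i, j, h, hodd⟩ := hG n hn hev _ (isCycleEmb_nat G (by omega) g hinj hadj hlast)
  obtain ⟨a, b, c, d, e, f1, f2⟩ := chord_nat G (by omega) g i j h
  refine ⟨_, _, a, b, ?_, c, d, e, f1, f2⟩
  have : NeZero n := ⟨by omega⟩
  have hj : j.val = ((j - i).val + i.val) % n := by
    rw [← ZMod.val_add, sub_add_cancel]
  obtain ⟨m, hm⟩ := hev
  obtain ⟨t, ht⟩ := hodd
  have hlt := ZMod.val_lt (j - i)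
  rcases Nat.lt_or_ge ((j - i).val + i.val) n with h2 | h2
  · rw [Nat.mod_eq_of_lt h2] at hj; omega
  · rw [Nat.mod_eq_sub_mod h2, Nat.mod_eq_of_lt (by omega)] at hj; omega

theorem chord_path {V : Type*} (G : SimpleGraph V) (hG : G.Chordal) (v : V) (m : ℕ) :
    ∀ (q : ℕ → V), (∀ k, k < m → cadj G (q k) (q (k + 1))) → G.Adj v (q 0) → G.Adj v (q m) →
      (∀ k, 0 < k → k < m → ¬ cadj G v (q k)) → cadj G (q 0) (q m) := by
  induction m using Nat.strong_induction_on with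
  | _ m ih =>
    intro q hq h0 hm hv
    rcases Nat.lt_or_ge m 2 with h | h2
    · interval_cases m
      · exact cadj_refl _ _
      · exact hq 0 (by omega)
    by_contra hcon
    have hno : ∀ a b, a + 1 < b → b ≤ m → ¬ cadj G (q a) (q b) := by
      intro a b hab hb hR
      have hne : ¬ (a = 0 ∧ b = m) := by
        rintro ⟨rfl, rfl⟩; exact hcon hR
      apply hcon
      have := ih (m - (b - a - 1)) (by omega)
        (fun k => if k ≤ a then q k else q (k + (b - a - 1))) ?_ ?_ ?_ ?_
      · simp only [Nat.zero_le, if_true] at this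
        rw [if_neg (by omega), show m - (b - a - 1) + (b - a - 1) = m by omega] at this
        exact this
      · intro k hk
        rcases lt_trichotomy k a with h | h | h
        · simp only [if_pos h.le, if_pos (show k + 1 ≤ a by omega)]
          exact hq k (by omega)
        · subst h
          simp only [le_refl, if_true, if_neg (show ¬ k + 1 ≤ k by omega)]
          rw [show k + 1 + (b - k - 1) = b by omega]; exact hR
        · simp only [if_neg (show ¬ k ≤ a by omega), if_neg (show ¬ k + 1 ≤ a by omega)]
          rw [show k + 1 + (b - a - 1) = k + (b - a - 1) + 1 by omega]
          exact hq _ (by omega)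
      · simpa using h0
      · beta_reduce
        rw [if_neg (by omega), show m - (b - a - 1) + (b - a - 1) = m by omega]
        exact hm
      · intro k hk1 hk2
        split_ifs
        · exact hv k hk1 (by omega)
        · exact hv _ (by omega) (by omega)
    have hinj : ∀ a b, a < b → b ≤ m → q a ≠ q b := by
      intro a b hab hb heq
      rcases Nat.lt_or_ge (a + 1) b with h | h
      · exact hno a b h hb (Or.inl heq)
      · have hb' : b = a + 1 := by omega
        subst hb'
        rcases Nat.lt_or_ge (a + 1) m with h' | h'
        · apply hno a (a + 2) (by omega) (by omega)
          rw [heq]; exact hq _ h'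
        · apply hno (a - 1) (a + 1) (by omega) hb
          rw [← heq]
          have := hq (a - 1) (by omega)
          rwa [show a - 1 + 1 = a by omega] at this
    have hvq : ∀ k, k ≤ m → q k ≠ v := by
      intro k hk he
      rcases Nat.eq_zero_or_pos k with h | h
      · subst h; rw [he] at h0; exact G.irrefl h0
      · rcases Nat.lt_or_ge k m with h' | h'
        · exact hv k h h' (Or.inl he.symm)
        · have : k = m := by omega
          subst this; rw [he] at hm; exact G.irrefl hm
    have key := chordal_nat G hG (n := m + 2) (by omega)
      (fun k => if k ≤ m then q k else v) ?_ ?_ ?_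
    · obtain ⟨i, j, hij, hj, hadj, h1, h3⟩ := key
      simp only [if_pos (show i ≤ m by omega)] at hadj
      split_ifs at hadj with hjm
      · exact hno i j (by omega) hjm (Or.inr hadj)
      · exact hv i (by omega) (by omega) (Or.inr hadj.symm)
    · intro a b hab hb
      simp only [if_pos (show a ≤ m by omega)]
      split_ifs with h
      · exact hinj a b hab h
      · exact hvq a (by omega)
    · intro k hk
      simp only [if_pos (show k ≤ m by omega)]
      split_ifs with h
      · rcases hq k (by omega) with h' | h'
        · exact absurd h' (hinj _ _ (by omega) h)
        · exact h'
      · rw [show k = m by omega]; exact hm.symm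
    · simp only [if_neg (show ¬ (m + 2 - 1 ≤ m) by omega), Nat.zero_le, if_true]
      exact h0

/-- no induced cycle (length at least six) in the neighbourhood matrix -/
theorem no_induced {V : Type*} (G : SimpleGraph V) (hC : G.Chordal)
    (hG : ∀ (n : ℕ), 6 ≤ n → Even n → ∀ f : ZMod n → V, G.IsCycleEmb f →
        ∃ i j, G.IsStrongChordOf f i j) {n : ℕ} (hn : 6 ≤ n) (hev : Even n)
    (p : ℕ → V)
    (hinj : ∀ a b, a < n → b < n → (a + b) % 2 = 0 → p a = p b → a = b)
    (hR : ∀ a b, a < n → b < n → (a + b) % 2 = 1 →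
      (cadj G (p a) (p b) ↔
        (b = a + 1 ∨ a = b + 1 ∨ (a = 0 ∧ b = n - 1) ∨ (b = 0 ∧ a = n - 1)))) : False := by
  have hn2 : n % 2 = 0 := Nat.even_iff.mp hev
  -- no coincidences
  have hco : ∀ a b, a < n → b < n → (b = a + 1 ∨ (a = n - 1 ∧ b = 0)) → p a ≠ p b := by
    intro a b ha hb hab heq
    let s : ℕ → ℕ := fun k => if k + 1 + b < n then k + 1 + b else k + 1 + b - n
    have hs : ∀ k, s k = if k + 1 + b < n then k + 1 + b else k + 1 + b - n := fun k => rfl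
    have hlt : ∀ k, k ≤ n - 3 → s k < n := by
      intro k hk; rw [hs]; split_ifs <;> omega
    -- relation of v to the path
    have hv : ∀ k, k ≤ n - 3 → (cadj G (p b) (p (s k)) ↔ (k = 0 ∨ k = n - 3)) := by
      intro k hk
      have h1 := hlt k hk
      rcases Nat.mod_two_eq_zero_or_one (b + s k) with h | h
      · rw [← heq, hR a (s k) ha h1 (by omega)]
        rw [hs] at h ⊢
        split_ifs at h ⊢ <;> omega
      · rw [hR b (s k) hb h1 h]
        rw [hs] at h ⊢
        split_ifs at h ⊢ <;> omega
    have hne : ∀ k, k ≤ n - 3 → p b ≠ p (s k) := by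
      intro k hk he
      have h1 := hlt k hk
      rcases Nat.mod_two_eq_zero_or_one (b + s k) with h | h
      · have := hinj b (s k) hb h1 h he
        rw [hs] at this
        split_ifs at this <;> omega
      · have := hinj a (s k) ha h1 (by omega) (heq.trans he)
        rw [hs] at this
        split_ifs at this <;> omega
    have hva : ∀ k, k ≤ n - 3 → (k = 0 ∨ k = n - 3) → G.Adj (p b) (p (s k)) := by
      intro k hk hk'
      rcases (hv k hk).2 hk' with h | h
      · exact absurd h (hne k hk)
      · exact h
    have := chord_path G hC (p b) (n - 3) (fun k => p (s k)) ?_ (hva 0 (by omega) (by omega))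
      (hva (n-3) (by omega) (by omega)) ?_
    · beta_reduce at this
      rw [hR _ _ (hlt 0 (by omega)) (hlt _ le_rfl)] at this
      · rw [hs, hs] at this
        split_ifs at this <;> omega
      · rw [hs, hs]
        split_ifs <;> omega
    · intro k hk
      rw [hR _ _ (hlt k (by omega)) (hlt _ (by omega))]
      · rw [hs, hs]
        split_ifs <;> omega
      · rw [hs, hs]
        split_ifs <;> omega
    · intro k hk1 hk2 h
      have := (hv k (by omega)).1 h
      omega
  have hinj' : ∀ a b, a < b → b < n → p a ≠ p b := by
    intro a b hab hb heq
    rcases Nat.mod_two_eq_zero_or_one (a + b) with h | h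
    · have := hinj a b (by omega) hb h heq
      omega
    · have := (hR a b (by omega) hb h).1 (Or.inl heq)
      rcases this with h | h | h | h
      · exact hco a b (by omega) hb (Or.inl h) heq
      · omega
      · exact hco b a hb (by omega) (Or.inr ⟨h.2, h.1⟩) heq.symm
      · omega
  have key := strong_nat G hG hn hev p hinj' ?_ ?_
  · obtain ⟨i, j, hi, hj, hodd, hadj, h1, h2, h3, h4⟩ := key
    have := (hR i j hi hj hodd).1 (Or.inr hadj)
    omega
  · intro k hk
    rcases (hR k (k+1) (by omega) hk (by omega)).2 (Or.inl rfl) with h | h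
    · exact absurd h (hinj' _ _ (by omega) hk)
    · exact h
  · rcases (hR (n-1) 0 (by omega) (by omega) (by omega)).2 (by omega) with h | h
    · exact absurd h.symm (hinj' _ _ (by omega) (by omega))
    · exact h

end helpers

section order
open Matrix


theorem quad_expand {V : Type*} [Fintype V] [DecidableEq V] (M : Matrix V V ℤ) (hM : Mᵀ = M)
    (x : V → ℤ) (a b : V) (d : ℤ) (haa : M a a = 1) (hbb : M b b = 1) :
    (x + d • (Pi.single a 1 - Pi.single b 1)) ⬝ᵥ (M *ᵥ (x + d • (Pi.single a 1 - Pi.single b 1)))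
      = x ⬝ᵥ (M *ᵥ x) + 2 * d * ((M *ᵥ x) a - (M *ᵥ x) b) + d ^ 2 * (2 - 2 * M a b) := by
  have hba : M b a = M a b := by
    conv_lhs => rw [← hM]
    rfl
  have h1 : ∀ c, x ⬝ᵥ (M *ᵥ (Pi.single c 1)) = (M *ᵥ x) c := by
    intro c
    rw [Matrix.dotProduct_mulVec, ← Matrix.mulVec_transpose, hM]
    simp
  simp only [Matrix.mulVec_add, Matrix.mulVec_smul, Matrix.mulVec_sub, dotProduct_add,
    add_dotProduct, dotProduct_smul, smul_dotProduct, dotProduct_sub, sub_dotProduct, h1,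
    single_one_dotProduct, smul_eq_mul]
  simp [haa, hbb, hba]
  ring

open Classical in
theorem exists_lex_order {V : Type*} [Fintype V] (G : SimpleGraph V) :
    ∃ σ : Fin (Fintype.card V) ≃ V, ∀ i j, i < j → ∀ c, cadj G (σ i) (σ c) →
      ¬ cadj G (σ j) (σ c) → ∃ d, c < d ∧ cadj G (σ j) (σ d) ∧ ¬ cadj G (σ i) (σ d) := by
  let M : Matrix V V ℤ := fun u v => if cadj G u v then 1 else 0
  let x : (Fin (Fintype.card V) ≃ V) → V → ℤ := fun σ v => 2 ^ (σ.symm v).val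
  have hne : Nonempty (Fin (Fintype.card V) ≃ V) := ⟨(Fintype.equivFin V).symm⟩
  obtain ⟨σ, hσ⟩ := Finite.exists_max
    (fun σ : Fin (Fintype.card V) ≃ V => x σ ⬝ᵥ (Matrix.mulVec M (x σ)))
  refine ⟨σ, ?_⟩
  have hM : Mᵀ = M := by
    ext u v
    show (if cadj G v u then (1 : ℤ) else 0) = if cadj G u v then 1 else 0
    rw [show cadj G v u = cadj G u v from propext ⟨cadj_symm, cadj_symm⟩]
  have hdiag : ∀ v, M v v = 1 := fun v => if_pos (cadj_refl G v)
  have hrow : ∀ i j, i < j → (Matrix.mulVec M (x σ)) (σ i) ≤ (Matrix.mulVec M (x σ)) (σ j) := by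
    intro i j hij
    by_contra hcon
    push Not at hcon
    have h := hσ ((Equiv.swap i j).trans σ)
    have hd : (0 : ℤ) < 2 ^ j.val - 2 ^ i.val := by
      have : (2 : ℤ) ^ i.val < 2 ^ j.val := pow_lt_pow_right₀ (by norm_num) hij
      omega
    have hx : x ((Equiv.swap i j).trans σ) =
        x σ + ((2 : ℤ) ^ j.val - 2 ^ i.val) • (Pi.single (σ i) 1 - Pi.single (σ j) 1) := by
      funext v
      obtain ⟨k, rfl⟩ := σ.surjective v
      simp only [x, Pi.add_apply, Pi.smul_apply, Pi.sub_apply, Pi.single_apply, smul_eq_mul,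
        Equiv.symm_trans_apply, Equiv.symm_apply_apply, Equiv.symm_swap, σ.injective.eq_iff]
      by_cases h1 : k = i
      · subst h1; simp [hij.ne]
      · by_cases h2 : k = j
        · subst h2; simp [hij.ne']
        · simp [Equiv.swap_apply_of_ne_of_ne h1 h2, h1, h2]
    beta_reduce at h
    rw [hx, quad_expand M hM _ _ _ _ (hdiag _) (hdiag _)] at h
    have hMle : M (σ i) (σ j) ≤ 1 := by
      simp only [M]; split_ifs <;> norm_num
    nlinarith [mul_pos hd (sub_pos.2 hcon), mul_nonneg (sq_nonneg ((2 : ℤ) ^ j.val - 2 ^ i.val))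
      (sub_nonneg.2 hMle)]
  let S : Fin (Fintype.card V) → Finset ℕ := fun i =>
    (Finset.univ.filter (fun k => cadj G (σ i) (σ k))).map Fin.valEmbedding
  have hS : ∀ i, (Matrix.mulVec M (x σ)) (σ i) = ((∑ k ∈ S i, 2 ^ k : ℕ) : ℤ) := by
    intro i
    simp only [Matrix.mulVec, dotProduct, S, Finset.sum_map, Finset.sum_filter, M, x]
    rw [← Equiv.sum_comp σ]
    push_cast
    apply Finset.sum_congr rfl
    intro k _
    simp
  intro i j hij c h1 h2
  have h := hrow i j hij
  rw [hS, hS, Nat.cast_le, Finset.geomSum_le_geomSum_iff_toColex_le_toColex le_rfl,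
    Finset.Colex.toColex_le_toColex] at h
  obtain ⟨b, hb, hb2, hb3⟩ := h (a := c.val) (by
    simp only [S, Finset.mem_map, Finset.mem_filter, Finset.mem_univ, true_and,
      Fin.valEmbedding_apply]
    exact ⟨c, h1, rfl⟩)
    (by simpa [S, Fin.val_inj] using h2)
  simp only [S, Finset.mem_map, Finset.mem_filter, Finset.mem_univ, true_and,
    Fin.valEmbedding_apply] at hb hb2
  obtain ⟨d, hd, rfl⟩ := hb
  refine ⟨d, ?_, hd, fun h => hb2 ⟨d, h, rfl⟩⟩
  refine lt_of_le_of_ne hb3 ?_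
  rintro rfl
  exact h2 hd

end order

section gamma

/-- half of the invariant used in the construction of an induced cycle -/
def HalfInv {T : Type*} [LinearOrder T] (R : T → T → Prop) (r c : ℕ → T) (n : ℕ) : Prop :=
  (∀ a, a < n → r a < r (a + 1)) ∧
  (∀ a b, a ≤ n → b ≤ n → ¬ (a = n ∧ b = n) →
    (R (r a) (c b) ↔ (a + 1 = b ∨ b + 1 = a ∨ (a = 0 ∧ b = 0)))) ∧
  (∀ a, a + 2 ≤ n → ∀ e, c (a + 2) < e → (R (r a) e ↔ R (r (a + 1)) e))

theorem exists_lastDiff {T : Type*} [LinearOrder T] [Finite T] (R : T → T → Prop)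
    (hL : ∀ i j, i < j → ∀ c, R i c → ¬ R j c → ∃ d, c < d ∧ R j d ∧ ¬ R i d) :
    ∃ D : T → T → T, ∀ x y c, x < y → R x c → ¬ R y c →
      c < D x y ∧ R y (D x y) ∧ ¬ R x (D x y) ∧ ∀ e, D x y < e → (R x e ↔ R y e) := by
  have : ∀ x y : T, ∃ d, ∀ c, x < y → R x c → ¬ R y c →
      c < d ∧ R y d ∧ ¬ R x d ∧ ∀ e, d < e → (R x e ↔ R y e) := by
    intro x y
    by_cases hS : ∃ d, R y d ∧ ¬ R x d
    · obtain ⟨d, hd, hmax⟩ := (Set.toFinite {d | R y d ∧ ¬ R x d}).exists_maximalFor id _ hS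
      have hmax' : ∀ e, R y e → ¬ R x e → e ≤ d := by
        intro e h1 h2
        rcases le_total e d with h | h
        · exact h
        · exact hmax (show e ∈ {d | R y d ∧ ¬ R x d} from ⟨h1, h2⟩) h
      refine ⟨d, fun c hxy h1 h2 => ⟨?_, hd.1, hd.2, ?_⟩⟩
      · obtain ⟨e, he, h3, h4⟩ := hL x y hxy c h1 h2
        exact lt_of_lt_of_le he (hmax' e h3 h4)
      · intro e he
        constructor
        · intro h3
          by_contra h4
          obtain ⟨e', he', h5, h6⟩ := hL x y hxy e h3 h4
          exact absurd (hmax' e' h5 h6) (not_le.2 (he.trans he'))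
        · intro h3
          by_contra h4
          exact absurd (hmax' e h3 h4) (not_le.2 he)
    · refine ⟨x, fun c hxy h1 h2 => ?_⟩
      obtain ⟨e, he, h3, h4⟩ := hL x y hxy c h1 h2
      exact absurd ⟨e, h3, h4⟩ hS
  choose D hD using this
  exact ⟨D, hD⟩

theorem exists_seqs {T : Type*} (D : T → T → T) (i j k l : T) :
    ∃ r c : ℕ → T, r 0 = i ∧ r 1 = j ∧ c 0 = k ∧ c 1 = l ∧
      (∀ n, r (n + 2) = D (c n) (c (n + 1))) ∧ (∀ n, c (n + 2) = D (r n) (r (n + 1))) := by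
  let s : ℕ → T × T × T × T := fun n => Nat.rec (i, j, k, l)
    (fun _ q => (q.2.1, D q.2.2.1 q.2.2.2, q.2.2.2, D q.1 q.2.1)) n
  exact ⟨fun n => (s n).1, fun n => (s n).2.2.1, rfl, rfl, rfl, rfl, fun n => rfl, fun n => rfl⟩

theorem half_step {T : Type*} [LinearOrder T] (R : T → T → Prop)
    (D : T → T → T) (hD : ∀ x y c, x < y → R x c → ¬ R y c →
      c < D x y ∧ R y (D x y) ∧ ¬ R x (D x y) ∧ ∀ e, D x y < e → (R x e ↔ R y e))
    (r c : ℕ → T) (hc : ∀ n, c (n + 2) = D (r n) (r (n + 1))) (m : ℕ)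
    (h1 : HalfInv R r c (m + 1)) (h2 : HalfInv R c r (m + 1))
    (hn : ¬ R (r (m + 1)) (c (m + 1))) :
    c (m + 1) < c (m + 2) ∧ R (r (m + 1)) (c (m + 2)) ∧ (∀ a, a ≤ m → ¬ R (r a) (c (m + 2))) ∧
      ∀ e, c (m + 2) < e → (R (r m) e ↔ R (r (m + 1)) e) := by
  have hm : R (r m) (c (m + 1)) :=
    (h1.2.1 m (m + 1) (by omega) le_rfl (by omega)).2 (Or.inl rfl)
  obtain ⟨a1, a2, a3, a4⟩ := hD (r m) (r (m + 1)) (c (m + 1)) (h1.1 m (by omega)) hm hn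
  rw [← hc] at a1 a2 a3 a4
  refine ⟨a1, a2, ?_, a4⟩
  have hmono : ∀ t a, a + t = m + 1 → c a ≤ c (m + 1) := by
    intro t
    induction t with
    | zero => intro a ha; rw [show a = m + 1 by omega]
    | succ t ih =>
      intro a ha
      exact (h2.1 a (by omega)).le.trans (ih (a + 1) (by omega))
  have key : ∀ t a, a + t = m → ¬ R (r a) (c (m + 2)) := by
    intro t
    induction t with
    | zero => intro a ha; rw [show a = m by omega]; exact a3
    | succ t ih =>
      intro a ha
      rw [h1.2.2 a (by omega) _ (lt_of_le_of_lt (hmono (m + 1 - (a + 2)) (a + 2) (by omega)) a1)]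
      exact ih (a + 1) (by omega)
  intro a ha
  exact key (m - a) a (by omega)

theorem half_succ {T : Type*} [LinearOrder T] (R : T → T → Prop) (hsymm : ∀ a b, R a b → R b a)
    (D : T → T → T) (hD : ∀ x y c, x < y → R x c → ¬ R y c →
      c < D x y ∧ R y (D x y) ∧ ¬ R x (D x y) ∧ ∀ e, D x y < e → (R x e ↔ R y e))
    (r c : ℕ → T) (hc : ∀ n, c (n + 2) = D (r n) (r (n + 1)))
    (hr : ∀ n, r (n + 2) = D (c n) (c (n + 1))) (m : ℕ)
    (h1 : HalfInv R r c (m + 1)) (h2 : HalfInv R c r (m + 1))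
    (hn : ¬ R (r (m + 1)) (c (m + 1))) : HalfInv R r c (m + 2) := by
  obtain ⟨a1, a2, a3, a4⟩ := half_step R D hD r c hc m h1 h2 hn
  obtain ⟨b1, b2, b3, b4⟩ := half_step R D hD c r hr m h2 h1 (fun h => hn (hsymm _ _ h))
  refine ⟨?_, ?_, ?_⟩
  · intro a ha
    rcases Nat.lt_or_ge a (m + 1) with h | h
    · exact h1.1 a h
    · rw [show a = m + 1 by omega]; exact b1
  · intro a b ha hb hab
    by_cases ea : a = m + 2
    · subst ea
      by_cases eb : b = m + 1
      · subst eb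
        exact iff_of_true (hsymm _ _ b2) (by omega)
      · exact iff_of_false (fun h => b3 b (by omega) (hsymm _ _ h)) (by omega)
    · by_cases eb : b = m + 2
      · subst eb
        by_cases ea' : a = m + 1
        · subst ea'
          exact iff_of_true a2 (by omega)
        · exact iff_of_false (a3 a (by omega)) (by omega)
      · by_cases e : a = m + 1 ∧ b = m + 1
        · obtain ⟨rfl, rfl⟩ := e
          exact iff_of_false hn (by omega)
        · exact h1.2.1 a b (by omega) (by omega) e
  · intro a ha e he
    rcases Nat.lt_or_ge a m with h | h
    · exact h1.2.2 a (by omega) e he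
    · have : a = m := by omega
      subst this
      exact a4 e he

theorem gamma_cycle {T : Type*} [LinearOrder T] [Finite T] (R : T → T → Prop)
    (hsymm : ∀ a b, R a b → R b a)
    (hL : ∀ i j, i < j → ∀ c, R i c → ¬ R j c → ∃ d, c < d ∧ R j d ∧ ¬ R i d)
    (i j k l : T) (hij : i < j) (hkl : k < l) (hik : R i k) (hil : R i l) (hjk : R j k)
    (hjl : ¬ R j l) :
    ∃ (n : ℕ) (r c : ℕ → T), 2 ≤ n ∧ (∀ a, a < n → r a < r (a + 1)) ∧
      (∀ a, a < n → c a < c (a + 1)) ∧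
      ∀ a b, a ≤ n → b ≤ n → (R (r a) (c b) ↔
        (a + 1 = b ∨ b + 1 = a ∨ (a = 0 ∧ b = 0) ∨ (a = n ∧ b = n))) := by
  obtain ⟨D, hD⟩ := exists_lastDiff R hL
  obtain ⟨r, c, r0, r1, c0, c1, hr, hc⟩ := exists_seqs D i j k l
  have base1 : HalfInv R r c 1 := by
    refine ⟨?_, ?_, ?_⟩
    · intro a ha; rw [show a = 0 by omega]; simpa [r0, r1] using hij
    · intro a b ha hb hab
      have : (a = 0 ∧ b = 0) ∨ (a = 0 ∧ b = 1) ∨ (a = 1 ∧ b = 0) := by omega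
      rcases this with ⟨rfl, rfl⟩ | ⟨rfl, rfl⟩ | ⟨rfl, rfl⟩ <;> simp [r0, r1, c0, c1, hik, hil, hjk]
    · intro a ha; omega
  have base2 : HalfInv R c r 1 := by
    refine ⟨?_, ?_, ?_⟩
    · intro a ha; rw [show a = 0 by omega]; simpa [c0, c1] using hkl
    · intro a b ha hb hab
      have : (a = 0 ∧ b = 0) ∨ (a = 0 ∧ b = 1) ∨ (a = 1 ∧ b = 0) := by omega
      rcases this with ⟨rfl, rfl⟩ | ⟨rfl, rfl⟩ | ⟨rfl, rfl⟩ <;>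
        simp [r0, r1, c0, c1, hsymm _ _ hik, hsymm _ _ hil, hsymm _ _ hjk]
    · intro a ha; omega
  have inv : ∀ m, (∀ t, t < m → ¬ R (r (t + 1)) (c (t + 1))) →
      HalfInv R r c (m + 1) ∧ HalfInv R c r (m + 1) := by
    intro m
    induction m with
    | zero => intro _; exact ⟨base1, base2⟩
    | succ m ih =>
      intro h
      obtain ⟨h1, h2⟩ := ih (fun t ht => h t (by omega))
      have hn := h m (by omega)
      exact ⟨half_succ R hsymm D hD r c hc hr m h1 h2 hn,
        half_succ R hsymm D hD c r hr hc m h2 h1 (fun h => hn (hsymm _ _ h))⟩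
  by_cases hex : ∃ t, R (r (t + 1)) (c (t + 1))
  · classical
    have hspec := Nat.find_spec hex
    have hmin : ∀ t, t < Nat.find hex → ¬ R (r (t + 1)) (c (t + 1)) :=
      fun t ht => Nat.find_min hex ht
    generalize Nat.find hex = m at hspec hmin
    obtain ⟨h1, h2⟩ := inv m hmin
    have hm : m ≠ 0 := by
      rintro rfl
      rw [r1, c1] at hspec
      exact hjl hspec
    refine ⟨m + 1, r, c, by omega, h1.1, h2.1, ?_⟩
    intro a b ha hb
    by_cases e : a = m + 1 ∧ b = m + 1
    · obtain ⟨rfl, rfl⟩ := e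
      exact iff_of_true hspec (by omega)
    · rw [h1.2.1 a b ha hb e]
      omega
  · exfalso
    have hno : ∀ t, ¬ R (r (t + 1)) (c (t + 1)) := fun t h => hex ⟨t, h⟩
    have hmono : StrictMono r := strictMono_nat_of_lt_succ
      (fun a => (inv a (fun t _ => hno t)).1.1 a (by omega))
    exact not_injective_infinite_finite r hmono.injective

theorem strict_aux {T : Type*} [LinearOrder T] (r : ℕ → T) (n : ℕ)
    (h : ∀ a, a < n → r a < r (a + 1)) : ∀ a b, a ≤ n → b ≤ n → r a = r b → a = b := by
  have key : ∀ t a, a + t + 1 ≤ n → r a < r (a + t + 1) := by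
    intro t
    induction t with
    | zero => intro a ha; exact h a (by omega)
    | succ t ih => intro a ha; exact (ih a (by omega)).trans (h _ (by omega))
  intro a b ha hb hab
  rcases lt_trichotomy a b with h | h | h
  · have := key (b - a - 1) a (by omega)
    rw [show a + (b - a - 1) + 1 = b by omega, hab] at this
    exact absurd this (lt_irrefl _)
  · exact h
  · have := key (a - b - 1) b (by omega)
    rw [show b + (a - b - 1) + 1 = a by omega, hab] at this
    exact absurd this (lt_irrefl _)

theorem hard_dir {V : Type*} [Fintype V] (G : SimpleGraph V) (hC : G.Chordal)
    (hG : ∀ (n : ℕ), 6 ≤ n → Even n → ∀ f : ZMod n → V, G.IsCycleEmb f →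
        ∃ i j, G.IsStrongChordOf f i j) :
    ∃ σ : Fin (Fintype.card V) ≃ V, G.IsStrongElimOrdering σ := by
  obtain ⟨σ, hσ⟩ := exists_lex_order G
  refine ⟨σ, ?_⟩
  intro i j k l hij hkl h1 h2 h3
  rw [mem_closedNbhd_iff_cadj] at h1 h2 h3 ⊢
  by_contra h4
  obtain ⟨n, r, c, hn, hr, hc, hR⟩ := gamma_cycle (fun a b => cadj G (σ a) (σ b))
    (fun a b h => cadj_symm h) hσ i j k l hij hkl h1 h2 h3 h4
  have rinj := strict_aux r n hr
  have cinj := strict_aux c n hc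
  -- the height function
  let ht : ℕ → ℕ := fun t => if t ≤ n then t else 2 * n + 1 - t
  have hht : ∀ t, ht t = if t ≤ n then t else 2 * n + 1 - t := fun t => rfl
  have hle : ∀ t, ht t ≤ n := by
    intro t; rw [hht]; split_ifs <;> omega
  have hinjt : ∀ a b, a < 2 * n + 2 → b < 2 * n + 2 → (a + b) % 2 = 0 → ht a = ht b → a = b := by
    intro a b ha hb hab h
    rw [hht, hht] at h
    split_ifs at h <;> omega
  apply no_induced G hC hG (n := 2 * n + 2) (by omega) ⟨n + 1, by ring⟩
    (fun t => if t % 2 = 0 then σ (r (ht t)) else σ (c (ht t)))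
  · intro a b ha hb hab h
    beta_reduce at h
    apply hinjt a b ha hb hab
    rcases Nat.mod_two_eq_zero_or_one a with e | e
    · rw [if_pos e, if_pos (by omega)] at h
      exact rinj _ _ (hle _) (hle _) (σ.injective h)
    · rw [if_neg (by omega), if_neg (by omega)] at h
      exact cinj _ _ (hle _) (hle _) (σ.injective h)
  · intro a b ha hb hab
    beta_reduce
    rcases Nat.mod_two_eq_zero_or_one a with e | e
    · rw [if_pos e, if_neg (by omega)]
      refine (hR (ht a) (ht b) (hle _) (hle _)).trans ?_
      rw [hht, hht]
      split_ifs <;> omega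
    · rw [if_neg (by omega), if_pos (by omega)]
      refine (show _ ↔ _ from ⟨cadj_symm, cadj_symm⟩).trans
        ((hR (ht b) (ht a) (hle _) (hle _)).trans ?_)
      rw [hht, hht]
      split_ifs <;> omega

end gamma

/-- Farber: a finite simple graph admits a strong elimination ordering iff it is
chordal and every even cycle of length at least 6 has a strong chord. -/
theorem exists_strongElimOrdering_iff_chordal_and_strongChord {V : Type*} [Fintype V]
    (G : SimpleGraph V) :
    (∃ σ : Fin (Fintype.card V) ≃ V, G.IsStrongElimOrdering σ) ↔
      (G.Chordal ∧ ∀ (n : ℕ), 6 ≤ n → Even n → ∀ f : ZMod n → V, G.IsCycleEmb f →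
        ∃ i j, G.IsStrongChordOf f i j) := by
  constructor
  · rintro ⟨σ, hσ⟩
    exact easy_dir G σ hσ
  · rintro ⟨hC, hG⟩
    exact hard_dir G hC hG
end
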